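/- arXiv:0810.5352 — 2 statements merged into one kernel-verified Lean document; each statement's English description precedes it below -/
import Mathlib

section
/- Let K be a compact Hausdorff space and let f : C(K) → ℂ be an orthogonally additive holomorphic function of bounded type. Then f is integral on every ball: for every integer n ≥ 1 there exists a complex Borel measure ν on the closed unit ball B' of the dual of C(K), equipped with the weak-* topology, such that f(x) = ∫_{B'} 1/(1 − γ(x)/n) dν(γ) for every x ∈ C(K) with ‖x‖ < n. -/
open MeasureTheory Filter Topology

/-- `f` is orthogonally additive when it is additive on orthogonal pairs. -/
def IsOrthAdd {K : Type*} [TopologicalSpace K] [CompactSpace K]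
    (f : C(K, ℂ) → ℂ) : Prop :=
  ∀ x y : C(K, ℂ), x * y = 0 → f (x + y) = f x + f y

/-- `P` is a continuous `k`-homogeneous polynomial on `C(K, ℂ)`. -/
def IsHomogPoly {K : Type*} [TopologicalSpace K] [CompactSpace K]
    (k : ℕ) (P : C(K, ℂ) → ℂ) : Prop :=
  ∃ M : ContinuousMultilinearMap ℂ (fun _ : Fin k => C(K, ℂ)) ℂ,
    ∀ x : C(K, ℂ), P x = M (fun _ => x)

/-- The norm `‖P‖ = sup_{‖x‖ ≤ 1} |P x|` of a polynomial on `C(K, ℂ)`. -/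
noncomputable def polyNorm {K : Type*} [TopologicalSpace K] [CompactSpace K]
    (P : C(K, ℂ) → ℂ) : ℝ :=
  sSup ((fun x => ‖P x‖) '' Metric.closedBall (0 : C(K, ℂ)) 1)

/-- The closed unit ball of the dual of `C(K, ℂ)`, with the weak-* topology. -/
abbrev DualBall (K : Type*) [TopologicalSpace K] [CompactSpace K] : Type _ :=
  {γ : WeakDual ℂ C(K, ℂ) // ∀ x : C(K, ℂ), ‖γ x‖ ≤ ‖x‖}

/-- Borel σ-algebra on the weak-* dual unit ball. -/
noncomputable instance (K : Type*) [TopologicalSpace K] [CompactSpace K] :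
    MeasurableSpace (DualBall K) := borel (DualBall K)

section
open MeasureTheory Filter Topology

theorem aux_toggle {ι : Type*} [Fintype ι] [DecidableEq ι] (j : ι) (F : Finset ι → ℂ)
    (hF : ∀ T, j ∉ T → F (insert j T) = F T) :
    ∑ T : Finset ι, (-1 : ℂ) ^ T.card * F T = 0 := by
  have h := Finset.sum_powerset_insert (s := (Finset.univ : Finset ι).erase j) (a := j)
    (Finset.notMem_erase j _) (fun T => (-1 : ℂ) ^ T.card * F T)
  rw [Finset.insert_erase (Finset.mem_univ j), Finset.powerset_univ] at h
  rw [h, ← Finset.sum_add_distrib]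
  apply Finset.sum_eq_zero
  intro T hT
  have hj : j ∉ T := fun hj => by
    have := Finset.mem_powerset.1 hT hj
    simp at this
  rw [hF T hj, Finset.card_insert_of_notMem hj, pow_succ]
  ring

theorem aux_polar {E : Type*} [AddCommGroup E] [Module ℂ E] {k : ℕ}
    (M : MultilinearMap ℂ (fun _ : Fin k => E) ℂ) (z : Fin k → E) :
    ∑ T : Finset (Fin k), (-1 : ℂ) ^ T.card * M (fun _ => ∑ i ∈ T, z i)
      = (-1) ^ k * ∑ σ : Equiv.Perm (Fin k), M (fun i => z (σ i)) := by
  classical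
  have h1 : ∀ T : Finset (Fin k), M (fun _ => ∑ i ∈ T, z i)
      = ∑ g : Fin k → Fin k, if (∀ i, g i ∈ T) then M (fun i => z (g i)) else 0 := by
    intro T
    rw [M.map_sum_finset (fun _ => z) (fun _ => T), ← Finset.sum_filter]
    apply Finset.sum_congr _ (fun _ _ => rfl)
    ext g; simp [Fintype.mem_piFinset]
  simp_rw [h1, Finset.mul_sum]
  rw [Finset.sum_comm]
  have h2 : ∀ g : Fin k → Fin k, ∑ T : Finset (Fin k), (-1 : ℂ) ^ T.card *
      (if (∀ i, g i ∈ T) then M (fun i => z (g i)) else 0)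
      = if Function.Bijective g then (-1) ^ k * M (fun i => z (g i)) else 0 := by
    intro g
    split_ifs with hg
    · rw [Finset.sum_eq_single Finset.univ]
      · simp
      · intro T _ hT
        rw [if_neg, mul_zero]
        intro h
        apply hT
        ext j
        obtain ⟨i, rfl⟩ := hg.2 j
        simp [h i]
      · simp
    · have : ¬ Function.Surjective g := fun h => hg (Finite.surjective_iff_bijective.1 h)
      simp only [Function.Surjective, not_forall, not_exists] at this
      obtain ⟨j, hj⟩ := this
      apply aux_toggle j (fun T => if (∀ i, g i ∈ T) then M (fun i => z (g i)) else 0)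
      intro T _
      simp [hj]
  simp_rw [h2]
  rw [← Finset.sum_filter]
  symm
  apply Finset.sum_bij (fun (σ : Equiv.Perm (Fin k)) _ => (σ : Fin k → Fin k))
  · intro σ _; exact Finset.mem_filter.2 ⟨Finset.mem_univ _, σ.bijective⟩
  · intro a _ b _ h; exact DFunLike.coe_injective h
  · intro g hg
    exact ⟨Equiv.ofBijective g (by simpa using hg), by simp, by ext; simp⟩
  · intro σ _; rfl

theorem aux_vanish {K : Type*} [TopologicalSpace K] [CompactSpace K] {k : ℕ}
    (M : MultilinearMap ℂ (fun _ : Fin k => C(K, ℂ)) ℂ)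
    (hO : ∀ x y : C(K, ℂ), x * y = 0 → M (fun _ => x + y) = M (fun _ => x) + M (fun _ => y))
    (z : Fin k → C(K, ℂ)) (S : Finset (Fin k)) (i₀ j₀ : Fin k) (hi : i₀ ∈ S) (hj : j₀ ∉ S)
    (hz : ∀ i ∈ S, ∀ j ∉ S, z i * z j = 0) :
    ∑ σ : Equiv.Perm (Fin k), M (fun i => z (σ i)) = 0 := by
  classical
  have h := aux_polar M z
  have h1 : ∀ T : Finset (Fin k), M (fun _ => ∑ i ∈ T, z i)
      = M (fun _ => ∑ i ∈ T ∩ S, z i) + M (fun _ => ∑ i ∈ T \ S, z i) := by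
    intro T
    rw [← Finset.sum_inter_add_sum_sdiff T S z, hO]
    rw [Finset.sum_mul_sum]
    apply Finset.sum_eq_zero
    intro i hi
    apply Finset.sum_eq_zero
    intro j hj
    exact hz i (Finset.mem_inter.1 hi).2 j (Finset.mem_sdiff.1 hj).2
  rw [Finset.sum_congr rfl (fun T _ => by rw [h1 T, mul_add]), Finset.sum_add_distrib] at h
  rw [aux_toggle j₀ (fun T => M (fun _ => ∑ i ∈ T ∩ S, z i)),
    aux_toggle i₀ (fun T => M (fun _ => ∑ i ∈ T \ S, z i))] at h
  · have h3 : ((-1 : ℂ)) ^ k ≠ 0 := pow_ne_zero _ (by norm_num)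
    rw [add_zero] at h
    exact (mul_eq_zero.1 h.symm).resolve_left h3
  · intro T _
    rw [Finset.insert_sdiff_of_mem _ hi]
  · intro T _
    rw [Finset.insert_inter_of_notMem hj]

end

section
open MeasureTheory Filter Topology

theorem aux_PL_half (h : ℂ → ℂ) (hd : Differentiable ℂ h) (C0 : ℝ)
    (hexp : ∃ B C : ℝ, ∀ z, ‖h z‖ ≤ C * Real.exp (B * ‖z‖))
    (him : ∀ x : ℝ, ‖h (x * Complex.I)‖ ≤ C0)
    (hre : ∀ ε : ℝ, 0 < ε → ∃ C : ℝ, ∀ x : ℝ, 0 ≤ x → ‖h x‖ ≤ C * Real.exp (ε * x))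
    (z : ℂ) (hz : 0 ≤ z.re) : ‖h z‖ ≤ C0 := by
  have key : ∀ ε : ℝ, 0 < ε → ‖h z‖ ≤ C0 * Real.exp (ε * z.re) := by
    intro ε hε
    have h1 : ‖h z * Complex.exp (-ε * z)‖ ≤ C0 := by
      apply PhragmenLindelof.right_half_plane_of_bounded_on_real
        (f := fun z => h z * Complex.exp (-ε * z)) _ _ _ _ hz
      · apply Differentiable.diffContOnCl
        fun_prop
      · obtain ⟨B, C, hBC⟩ := hexp
        refine ⟨1, by norm_num, B, ?_⟩
        apply Asymptotics.IsBigO.of_bound C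
        apply Filter.mem_inf_of_right
        rw [Filter.mem_principal]
        intro w hw
        simp only [Set.mem_ofPred_eq] at hw ⊢
        rw [norm_mul, Complex.norm_exp, Real.rpow_one, Real.norm_eq_abs, Real.abs_exp]
        have : Real.exp ((-ε * w).re) ≤ 1 := by
          rw [Real.exp_le_one_iff]
          simp
          positivity
        calc _ ≤ ‖h w‖ * 1 := by gcongr
          _ ≤ _ := by rw [mul_one]; exact hBC w
      · obtain ⟨C, hC⟩ := hre ε hε
        refine ⟨C, ?_⟩
        rw [Filter.eventually_map]
        filter_upwards [Filter.eventually_ge_atTop 0] with x hx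
        rw [norm_mul, Complex.norm_exp]
        have : ((-ε : ℂ) * x).re = -(ε * x) := by simp
        rw [this, Real.exp_neg]
        have := hC x hx
        rw [← div_eq_mul_inv, div_le_iff₀ (Real.exp_pos _)]
        exact this
      · intro x
        rw [norm_mul, Complex.norm_exp]
        have : ((-ε : ℂ) * (x * Complex.I)).re = 0 := by simp
        rw [this, Real.exp_zero, mul_one]
        exact him x
    rw [norm_mul, Complex.norm_exp] at h1
    have : ((-ε : ℂ) * z).re = -(ε * z.re) := by simp
    rw [this, Real.exp_neg, ← div_eq_mul_inv, div_le_iff₀ (Real.exp_pos _)] at h1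
    exact h1
  have ht : Tendsto (fun ε : ℝ => C0 * Real.exp (ε * z.re)) (𝓝[>] 0) (𝓝 (C0 * Real.exp (0 * z.re))) := by
    apply Tendsto.mono_left _ nhdsWithin_le_nhds
    apply Continuous.tendsto
    fun_prop
  rw [zero_mul, Real.exp_zero, mul_one] at ht
  apply ge_of_tendsto ht
  filter_upwards [self_mem_nhdsWithin] with ε hε using key ε hε

theorem aux_PL (h : ℂ → ℂ) (hd : Differentiable ℂ h) (C0 : ℝ)
    (hexp : ∃ B C : ℝ, ∀ z, ‖h z‖ ≤ C * Real.exp (B * ‖z‖))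
    (him : ∀ x : ℝ, ‖h (x * Complex.I)‖ ≤ C0)
    (hre : ∀ ε : ℝ, 0 < ε → ∃ C : ℝ, ∀ x : ℝ, ‖h x‖ ≤ C * Real.exp (ε * |x|))
    (z w : ℂ) : h z = h w := by
  apply hd.apply_eq_apply_of_bounded
  rw [isBounded_iff_forall_norm_le]
  refine ⟨C0, ?_⟩
  rintro _ ⟨u, rfl⟩
  rcases le_total 0 u.re with hu | hu
  · refine aux_PL_half h hd C0 hexp him ?_ u hu
    intro ε hε
    obtain ⟨C, hC⟩ := hre ε hε
    exact ⟨C, fun x hx => by simpa [abs_of_nonneg hx] using hC x⟩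
  · have := aux_PL_half (fun v => h (-v)) (hd.comp differentiable_neg) C0 ?_ ?_ ?_ (-u) (by simpa using hu)
    · simpa using this
    · obtain ⟨B, C, hh⟩ := hexp
      exact ⟨B, C, fun z => by simpa using hh (-z)⟩
    · intro x
      simpa using him (-x)
    · intro ε hε
      obtain ⟨C, hC⟩ := hre ε hε
      exact ⟨C, fun x hx => by simpa [abs_of_nonneg hx] using hC (-x)⟩

noncomputable def exC {K : Type*} [TopologicalSpace K] (X : C(K, ℂ)) : C(K, ℂ) :=
  ⟨fun t => Complex.exp (X t), by fun_prop⟩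

theorem exC_eq {K : Type*} [TopologicalSpace K] [CompactSpace K] (X : C(K, ℂ)) :
    exC X = NormedSpace.exp X := by
  ext t
  have h := NormedSpace.map_exp (ContinuousMap.evalAlgHom ℂ ℂ t)
    (continuous_eval_const t) X
  simp only [ContinuousMap.evalAlgHom_apply] at h
  rw [h, ← Complex.exp_eq_exp_ℂ]
  rfl

theorem exC_diff {K : Type*} [TopologicalSpace K] [CompactSpace K] (X : C(K, ℂ)) (c : ℂ) :
    Differentiable ℂ (fun s : ℂ => exC ((s * c) • X)) := by
  intro s
  simp_rw [exC_eq]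
  have := (hasDerivAt_exp_smul_const (𝕂 := ℂ) X (s * c)).differentiableAt
  exact this.comp s (f := fun s => s * c) (by fun_prop)

def ofRealC {K : Type*} [TopologicalSpace K] (x : C(K, ℝ)) : C(K, ℂ) :=
  ⟨fun t => (x t : ℂ), by fun_prop⟩

end

section
open MeasureTheory Filter Topology

theorem aux_partition {K : Type*} [TopologicalSpace K] [CompactSpace K] (y : C(K, ℝ)) :
    ∃ (A L : ℕ) (ψ : ℕ → C(K, ℂ)), (∑ l ∈ Finset.range L, ψ l = 1) ∧
      (∀ l t, ‖ψ l t‖ ≤ 1) ∧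
      (∀ l t, ψ l t ≠ 0 → (l : ℝ) < y t + A ∧ y t + A < l + 2) := by
  obtain ⟨A, hA⟩ := exists_nat_ge (‖y‖ + 1)
  let τ : ℝ → ℝ := fun s => max 0 (min 1 s)
  have hτ : Continuous τ := by fun_prop
  let Q : ℕ → C(K, ℂ) := fun l => ofRealC ⟨fun t => τ (y t + A - l), by fun_prop⟩
  refine ⟨A, 2 * A, fun l => Q l - Q (l + 1), ?_, ?_, ?_⟩
  · rw [Finset.sum_range_sub']
    ext t
    have h1 := abs_le.1 ((Real.norm_eq_abs _) ▸ y.norm_coe_le_norm t)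
    have h2 : τ (y t + A - (0 : ℕ)) = 1 := by
      simp only [τ]
      rw [min_eq_left (by push_cast; linarith), max_eq_right (by norm_num)]
    have h3 : τ (y t + A - (2 * A : ℕ)) = 0 := by
      simp only [τ]
      rw [max_eq_left]
      exact (min_le_right _ _).trans (by push_cast; linarith)
    change ((τ (y t + A - (0 : ℕ)) : ℝ) : ℂ) - ((τ (y t + A - (2 * A : ℕ)) : ℝ) : ℂ) = 1
    rw [h2, h3]; simp
  · intro l t
    change ‖((τ (y t + A - l) : ℝ) : ℂ) - ((τ (y t + A - (l + 1 : ℕ)) : ℝ) : ℂ)‖ ≤ 1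
    rw [← Complex.ofReal_sub, Complex.norm_real, Real.norm_eq_abs, abs_le]
    simp only [τ]
    push_cast
    grind
  · intro l t h
    change ((τ (y t + A - l) : ℝ) : ℂ) - ((τ (y t + A - (l + 1 : ℕ)) : ℝ) : ℂ) ≠ 0 at h
    rw [← Complex.ofReal_sub, Complex.ofReal_ne_zero] at h
    simp only [τ] at h
    push_cast at h
    grind

def VanishOrth {K : Type*} [TopologicalSpace K] [CompactSpace K] {k : ℕ}
    (N : ContinuousMultilinearMap ℂ (fun _ : Fin (k + 1) => C(K, ℂ)) ℂ) : Prop :=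
  ∀ (z : Fin (k + 1) → C(K, ℂ)) (S : Finset (Fin (k + 1))) (i₀ j₀ : Fin (k + 1)), i₀ ∈ S → j₀ ∉ S →
    (∀ i ∈ S, ∀ j ∉ S, z i * z j = 0) → N z = 0

theorem aux_gap {k : ℕ} (g : Fin (k + 1) → ℕ) (i₀ j₀ : Fin (k + 1))
    (h : g i₀ + k + 2 < g j₀) : ∃ m, g i₀ < m ∧ m < g j₀ ∧ ∀ i, g i ≠ m := by
  obtain ⟨m, hm, hm2⟩ := Finset.exists_mem_notMem_of_card_lt_card
    (s := Finset.univ.image g) (t := Finset.Icc (g i₀ + 1) (g i₀ + k + 2)) (by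
      refine lt_of_le_of_lt Finset.card_image_le ?_
      simp
      omega)
  rw [Finset.mem_Icc] at hm
  refine ⟨m, by omega, by omega, fun i hi => hm2 (Finset.mem_image.2 ⟨i, Finset.mem_univ _, hi⟩)⟩

theorem aux_growth {K : Type*} [TopologicalSpace K] [CompactSpace K] {k : ℕ}
    (N : ContinuousMultilinearMap ℂ (fun _ : Fin (k + 1) => C(K, ℂ)) ℂ) (hN : VanishOrth N)
    (c : Fin (k + 1) → ℝ) (hc : ∑ i, c i = 0) (z : Fin (k + 1) → C(K, ℂ)) (y : C(K, ℝ)) :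
    ∃ C : ℝ, ∀ s : ℝ, ‖N (fun i => exC (((s : ℂ) * c i) • ofRealC y) * z i)‖
      ≤ C * Real.exp ((∑ i, |c i|) * (k + 4) * |s|) := by
  obtain ⟨A, L, ψ, hsum, hle, hsupp⟩ := aux_partition y
  refine ⟨(Fintype.piFinset (fun _ : Fin (k + 1) => Finset.range L)).card *
    (‖N‖ * ∏ i, ‖z i‖), fun s => ?_⟩
  have h1 : (fun i => exC (((s : ℂ) * c i) • ofRealC y) * z i) =
      fun i => ∑ l ∈ Finset.range L, ψ l * (exC (((s : ℂ) * c i) • ofRealC y) * z i) := by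
    funext i
    rw [← Finset.sum_mul, hsum, one_mul]
  rw [h1, N.map_sum_finset (fun i l => ψ l * (exC (((s : ℂ) * c i) • ofRealC y) * z i))]
  refine (norm_sum_le _ _).trans ?_
  rw [mul_assoc, ← nsmul_eq_mul]
  apply Finset.sum_le_card_nsmul
  intro g _
  by_cases hg : ∀ i j, g j ≤ g i + k + 2
  · set b : ℝ := (g 0 : ℝ) - A with hb
    have h2 : N (fun i => ψ (g i) * (exC (((s : ℂ) * c i) • ofRealC y) * z i)) =
        N (fun i => Complex.exp (-((s : ℂ) * c i * b)) •
          (ψ (g i) * (exC (((s : ℂ) * c i) • ofRealC y) * z i))) := by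
      rw [N.map_smul_univ, ← Complex.exp_sum]
      have : ∑ i, -((s : ℂ) * c i * b) = 0 := by
        rw [Finset.sum_neg_distrib, ← Finset.sum_mul, ← Finset.mul_sum]
        have : ∑ i, (c i : ℂ) = 0 := by exact_mod_cast hc
        rw [this]; simp
      rw [this]; simp
    rw [h2]
    refine (N.le_opNorm _).trans ?_
    rw [mul_assoc]
    refine mul_le_mul_of_nonneg_left ?_ (norm_nonneg _)
    have h3 : (∏ i, ‖z i‖) * Real.exp ((∑ i, |c i|) * (k + 4) * |s|) =
      ∏ i, (Real.exp (|c i| * (k + 4) * |s|) * ‖z i‖) := by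
      rw [Finset.prod_mul_distrib, ← Real.exp_sum, ← Finset.sum_mul, ← Finset.sum_mul, mul_comm]
    rw [h3]
    apply Finset.prod_le_prod (fun _ _ => norm_nonneg _)
    intro i _
    rw [ContinuousMap.norm_le _ (by positivity)]
    intro t
    change ‖Complex.exp (-((s : ℂ) * c i * b)) * (ψ (g i) t * (Complex.exp (((s : ℂ) * c i) * (y t : ℂ)) * z i t))‖ ≤ _
    by_cases h0 : ψ (g i) t = 0
    · rw [h0]; simp; positivity
    have h4 := hsupp _ _ h0
    have h5 : |y t - b| ≤ k + 4 := by
      have e1 : (g 0 : ℝ) ≤ g i + k + 2 := by exact_mod_cast hg i 0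
      have e2 : (g i : ℝ) ≤ g 0 + k + 2 := by exact_mod_cast hg 0 i
      rw [abs_le]; constructor <;> linarith
    have h6 : Complex.exp (-((s : ℂ) * c i * b)) * (ψ (g i) t * (Complex.exp (((s : ℂ) * c i) * (y t : ℂ)) * z i t))
      = Complex.exp ((s * c i * (y t - b) : ℝ)) * (ψ (g i) t * z i t) := by
      have : ((s * c i * (y t - b) : ℝ) : ℂ) = -((s : ℂ) * c i * b) + ((s : ℂ) * c i) * (y t : ℂ) := by
        push_cast; ring
      rw [this, Complex.exp_add]; ring
    rw [h6, norm_mul, norm_mul, Complex.norm_exp, Complex.ofReal_re]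
    have h7 : s * c i * (y t - b) ≤ |c i| * (k + 4) * |s| := by
      refine (le_abs_self _).trans ?_
      rw [abs_mul, abs_mul]
      calc |s| * |c i| * |y t - b| ≤ |s| * |c i| * (k + 4) := by gcongr
        _ = _ := by ring
    have h8 := (z i).norm_coe_le_norm t
    calc _ ≤ Real.exp (|c i| * (k + 4) * |s|) * (1 * ‖z i‖) := by
          gcongr
          exact hle _ _
      _ = _ := by rw [one_mul]
  · push Not at hg
    obtain ⟨i₀, j₀, hij⟩ := hg
    obtain ⟨m, hm1, hm2, hm3⟩ := aux_gap g i₀ j₀ hij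
    rw [hN _ (Finset.univ.filter (fun i => g i < m)) i₀ j₀ (by simpa using hm1)
      (by simpa using hm2.le)]
    · rw [norm_zero]; positivity
    · intro i hi j hj
      have hi : g i < m := by simpa using hi
      have hj : m ≤ g j := by simpa using hj
      have hj' := hm3 j
      ext t
      change ψ (g i) t * _ * (ψ (g j) t * _) = 0
      by_cases h0 : ψ (g i) t = 0
      · simp [h0]
      by_cases h0' : ψ (g j) t = 0
      · simp [h0']
      exfalso
      have e1 := hsupp _ _ h0
      have e2 := hsupp _ _ h0'
      have : (g i : ℝ) + 2 ≤ g j := by exact_mod_cast (by omega : g i + 2 ≤ g j)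
      linarith

theorem aux_norm_exC {K : Type*} [TopologicalSpace K] [CompactSpace K] (x : C(K, ℝ)) (w : ℂ) :
    ‖exC (w • ofRealC x)‖ ≤ Real.exp (|w.re| * ‖x‖) := by
  rw [ContinuousMap.norm_le _ (by positivity)]
  intro t
  change ‖Complex.exp (w * (x t : ℂ))‖ ≤ _
  rw [Complex.norm_exp, Real.exp_le_exp]
  have : (w * (x t : ℂ)).re = w.re * x t := by simp
  rw [this]
  refine (le_abs_self _).trans ?_
  rw [abs_mul]
  have := x.norm_coe_le_norm t
  rw [Real.norm_eq_abs] at this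
  gcongr

theorem aux_const {K : Type*} [TopologicalSpace K] [CompactSpace K] {k : ℕ}
    (N : ContinuousMultilinearMap ℂ (fun _ : Fin (k + 1) => C(K, ℂ)) ℂ) (hN : VanishOrth N)
    (c : Fin (k + 1) → ℝ) (hc : ∑ i, c i = 0) (z : Fin (k + 1) → C(K, ℂ)) (x : C(K, ℝ)) (w : ℂ) :
    N (fun i => exC ((w * c i) • ofRealC x) * z i) = N z := by
  have hb : ∀ s : ℂ, ‖N (fun i => exC ((s * c i) • ofRealC x) * z i)‖ ≤
      ‖N‖ * ((∏ i, Real.exp (|s.re * c i| * ‖x‖)) * ∏ i, ‖z i‖) := by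
    intro s
    refine (N.le_opNorm _).trans ?_
    rw [← Finset.prod_mul_distrib]
    gcongr with i
    refine (norm_mul_le _ _).trans ?_
    gcongr
    have := aux_norm_exC x (s * c i)
    simpa using this
  have h := aux_PL (fun s => N (fun i => exC ((s * c i) • ofRealC x) * z i)) ?_
    (‖N‖ * ∏ i, ‖z i‖) ?_ ?_ ?_ w 0
  · refine h.trans ?_
    congr 1
    funext i
    ext t
    change Complex.exp (((0 : ℂ) * c i) * (x t : ℂ)) * z i t = z i t
    simp
  · have h1 : Differentiable ℂ (fun s : ℂ => (fun i => exC ((s * c i) • ofRealC x) * z i)) := by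
      rw [differentiable_pi]
      intro i
      exact (exC_diff (ofRealC x) (c i)).mul_const (z i)
    have h2 : Differentiable ℂ N := (N.contDiff (n := 1)).differentiable (by norm_num)
    exact h2.comp h1
  · refine ⟨(∑ i, |c i|) * ‖x‖, ‖N‖ * ∏ i, ‖z i‖, fun s => (hb s).trans ?_⟩
    rw [mul_assoc, mul_comm (∏ i, ‖z i‖), ← Real.exp_sum]
    gcongr
    rw [Finset.sum_mul, Finset.sum_mul]
    apply Finset.sum_le_sum
    intro i _
    rw [abs_mul]
    calc |s.re| * |c i| * ‖x‖ ≤ ‖s‖ * |c i| * ‖x‖ := by gcongr; exact Complex.abs_re_le_norm s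
      _ = _ := by ring
  · intro τ
    refine (hb _).trans ?_
    simp
  · intro ε hε
    set D : ℝ := (∑ i, |c i|) * (k + 4) with hD
    have hD0 : 0 ≤ D := by positivity
    set lam : ℝ := (D + 1) / ε with hlam
    have hlam0 : 0 < lam := by positivity
    obtain ⟨C, hC⟩ := aux_growth N hN c hc z (lam • x)
    have hC0 : 0 ≤ C := by
      have := (norm_nonneg _).trans (hC 0)
      simpa using this
    refine ⟨C, fun s => ?_⟩
    have := hC (s / lam)
    have he : (fun i => exC ((((s / lam : ℝ) : ℂ) * c i) • ofRealC (lam • x)) * z i) =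
        (fun i => exC (((s : ℂ) * c i) • ofRealC x) * z i) := by
      funext i
      congr 1
      congr 1
      ext t
      change (((s / lam : ℝ) : ℂ) * c i) * ((lam * x t : ℝ) : ℂ) = ((s : ℂ) * c i) * (x t : ℂ)
      have : (lam : ℂ) ≠ 0 := by exact_mod_cast hlam0.ne'
      push_cast
      field_simp
    rw [he] at this
    refine this.trans ?_
    apply mul_le_mul_of_nonneg_left _ hC0
    rw [Real.exp_le_exp, abs_div, abs_of_pos hlam0, hlam, ← hD]
    rw [div_div_eq_mul_div, mul_div_assoc', div_le_iff₀ (by positivity)]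
    have := abs_nonneg s
    nlinarith [mul_nonneg this hε.le]

end

section
open MeasureTheory Filter Topology

theorem aux_exp_repr {K : Type*} [TopologicalSpace K] [CompactSpace K] {k : ℕ}
    (N : ContinuousMultilinearMap ℂ (fun _ : Fin (k + 1) => C(K, ℂ)) ℂ) (hN : VanishOrth N)
    (X : C(K, ℂ)) :
    N (fun _ => exC X) = N (Function.update (fun _ => 1) 0 (exC X ^ (k + 1))) := by
  let a : C(K, ℝ) := ⟨fun t => (X t).re, by fun_prop⟩
  let b : C(K, ℝ) := ⟨fun t => (X t).im, by fun_prop⟩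
  let c : Fin (k + 1) → ℝ := fun i => if i = 0 then k else -1
  have hc : ∑ i, c i = 0 := by
    rw [Fin.sum_univ_succ]
    simp [c, Fin.succ_ne_zero]
  rw [← aux_const N hN c hc (fun _ => exC X) a 1, ← aux_const N hN c hc _ b Complex.I]
  congr 1
  funext i
  ext t
  have hX : X t = ((X t).re : ℂ) + Complex.I * ((X t).im : ℂ) := by
    rw [mul_comm]; exact (Complex.re_add_im _).symm
  have h1 : (exC ((Complex.I * (c i : ℂ)) • ofRealC b) * (exC (((1 : ℂ) * (c i : ℂ)) • ofRealC a) * exC X)) t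
    = Complex.exp ((c i + 1) * X t) := by
    change Complex.exp ((Complex.I * (c i : ℂ)) * ((X t).im : ℂ)) *
      (Complex.exp (((1 : ℂ) * (c i : ℂ)) * ((X t).re : ℂ)) * Complex.exp (X t)) = _
    rw [← Complex.exp_add, ← Complex.exp_add]
    congr 1
    conv_rhs => rw [add_mul, hX]
    conv_lhs => rw [hX]
    simp
    ring
  rw [h1]
  by_cases hi : i = 0
  · subst hi
    simp only [Function.update_self, ContinuousMap.pow_apply]
    change _ = Complex.exp (X t) ^ (k + 1)
    rw [← Complex.exp_nat_mul]
    simp [c]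
  · rw [Function.update_of_ne hi]
    simp [c, hi]

theorem aux_log {K : Type*} [TopologicalSpace K] [CompactSpace K] (v : C(K, ℂ))
    (hv : ∀ t, 0 < (v t).re) : ∃ X : C(K, ℂ), exC X = v := by
  refine ⟨⟨fun t => Complex.log (v t), ?_⟩, ?_⟩
  · exact Continuous.clog v.continuous (fun t => Or.inl (hv t))
  · ext t
    change Complex.exp (Complex.log (v t)) = v t
    apply Complex.exp_log
    intro h
    have := hv t
    rw [h] at this
    simp at this

theorem aux_poly_le {K : Type*} [TopologicalSpace K] [CompactSpace K] {k : ℕ}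
    (P : C(K, ℂ) → ℂ) (hP : IsHomogPoly k P) (x : C(K, ℂ)) :
    ‖P x‖ ≤ polyNorm P * ‖x‖ ^ k := by
  obtain ⟨M, hM⟩ := hP
  have hbdd : BddAbove ((fun x => ‖P x‖) '' Metric.closedBall (0 : C(K, ℂ)) 1) := by
    refine ⟨‖M‖, ?_⟩
    rintro _ ⟨y, hy, rfl⟩
    simp only [hM]
    refine (M.le_opNorm _).trans ?_
    rw [Finset.prod_const]
    have : ‖y‖ ≤ 1 := by simpa using hy
    have : ‖y‖ ^ (Finset.univ : Finset (Fin k)).card ≤ 1 := pow_le_one₀ (norm_nonneg _) this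
    nlinarith [norm_nonneg M]
  have h1 : ∀ y : C(K, ℂ), ‖y‖ ≤ 1 → ‖P y‖ ≤ polyNorm P := fun y hy =>
    le_csSup hbdd ⟨y, by simpa using hy, rfl⟩
  have hs : ∀ (s : ℂ) (y : C(K, ℂ)), P (s • y) = s ^ k * P y := by
    intro s y
    rw [hM, hM, M.map_smul_univ (fun _ => s) (fun _ => y)]
    simp
  by_cases hx : x = 0
  · rcases Nat.eq_zero_or_pos k with rfl | hk
    · simpa using h1 x (by simp [hx])
    · have := hs 0 x
      rw [zero_smul, zero_pow hk.ne', zero_mul] at this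
      simp [hx, this, hk.ne']
  · have hn : 0 < ‖x‖ := norm_pos_iff.2 hx
    have h2 := h1 (((‖x‖ : ℂ)⁻¹) • x) (by rw [norm_smul]; simp [hn.ne'])
    rw [hs, norm_mul, norm_pow, norm_inv, Complex.norm_real, norm_norm, inv_pow] at h2
    rwa [inv_mul_le_iff₀ (by positivity), mul_comm] at h2

theorem aux_norm_pow {K : Type*} [TopologicalSpace K] [CompactSpace K] (x : C(K, ℂ)) (k : ℕ) :
    ‖x‖ ^ (k + 1) ≤ ‖x ^ (k + 1)‖ := by
  set q : ℝ := ‖x ^ (k + 1)‖ ^ (((k + 1 : ℕ) : ℝ)⁻¹) with hq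
  have hq0 : 0 ≤ q := by positivity
  have h1 : q ^ (k + 1) = ‖x ^ (k + 1)‖ :=
    Real.rpow_inv_natCast_pow (norm_nonneg _) (Nat.succ_ne_zero k)
  rw [← h1]
  apply pow_le_pow_left₀ (norm_nonneg _)
  rw [ContinuousMap.norm_le _ hq0]
  intro t
  apply le_of_pow_le_pow_left₀ (Nat.succ_ne_zero k) hq0
  rw [Nat.succ_eq_add_one, h1, ← norm_pow]
  exact (x ^ (k + 1)).norm_coe_le_norm t

theorem aux_repr {K : Type*} [TopologicalSpace K] [CompactSpace K] {k : ℕ}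
    (P : C(K, ℂ) → ℂ) (hP : IsHomogPoly (k + 1) P) (hO : IsOrthAdd P) :
    ∃ φ : C(K, ℂ) →L[ℂ] ℂ, (∀ x, P x = φ (x ^ (k + 1))) ∧ ‖φ‖ ≤ 5 * polyNorm P := by
  have hPle := aux_poly_le P hP
  obtain ⟨M, hM⟩ := hP
  let N : ContinuousMultilinearMap ℂ (fun _ : Fin (k + 1) => C(K, ℂ)) ℂ :=
    ((Nat.factorial (k + 1) : ℂ)⁻¹) • ∑ σ : Equiv.Perm (Fin (k + 1)), M.domDomCongr σ
  have hNa : ∀ z, N z = ((Nat.factorial (k + 1) : ℂ)⁻¹) *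
      ∑ σ : Equiv.Perm (Fin (k + 1)), M (fun i => z (σ i)) := by
    intro z
    simp only [N, _root_.smul_apply, _root_.sum_apply, smul_eq_mul]
    rfl
  have hNP : ∀ x, N (fun _ => x) = P x := by
    intro x
    rw [hNa, hM]
    have : (Nat.factorial (k + 1) : ℂ) ≠ 0 := by exact_mod_cast Nat.factorial_ne_zero _
    simp only [Finset.sum_const, Finset.card_univ, Fintype.card_perm, Fintype.card_fin, nsmul_eq_mul]
    field_simp
  have hN : VanishOrth N := by
    intro z S i₀ j₀ hi hj hz
    rw [hNa]
    have := aux_vanish M.toMultilinearMap (fun x y hxy => by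
      have := hO x y hxy
      rw [hM, hM, hM] at this
      exact this) z S i₀ j₀ hi hj hz
    have h2 : ∑ σ : Equiv.Perm (Fin (k + 1)), M (fun i => z (σ i)) = 0 := this
    rw [h2, mul_zero]
  let φ : C(K, ℂ) →L[ℂ] ℂ := N.toContinuousLinearMap (fun _ => 1) 0
  have hφ : ∀ y, φ y = N (Function.update (fun _ => 1) 0 y) := fun y => rfl
  have hexp : ∀ X : C(K, ℂ), P (exC X) = φ (exC X ^ (k + 1)) := by
    intro X
    rw [hφ, ← hNP, aux_exp_repr N hN X]
  have hpos : ∀ v : C(K, ℂ), (∀ t, 0 < (v t).re) → P v = φ (v ^ (k + 1)) := by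
    intro v hv
    obtain ⟨X, rfl⟩ := aux_log v hv
    exact hexp X
  have hall : ∀ x, P x = φ (x ^ (k + 1)) := by
    intro x
    let F : ℂ → ℂ := fun s => N (fun _ => s • (1 : C(K, ℂ)) + x)
    let G : ℂ → ℂ := fun s => φ ((s • (1 : C(K, ℂ)) + x) ^ (k + 1))
    have h1 : Differentiable ℂ (fun s : ℂ => s • (1 : C(K, ℂ)) + x) := by fun_prop
    have hF : Differentiable ℂ F := by
      have h2 : Differentiable ℂ N := (N.contDiff (n := 1)).differentiable (by norm_num)
      have h3 : Differentiable ℂ (fun s : ℂ => (fun _ : Fin (k + 1) => s • (1 : C(K, ℂ)) + x)) :=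
        differentiable_pi.2 (fun _ => h1)
      exact h2.comp h3
    have hG : Differentiable ℂ G := φ.differentiable.comp (h1.pow (k + 1))
    have hFG : F = G := by
      apply AnalyticOnNhd.eq_of_eventuallyEq (z₀ := ((‖x‖ + 1 : ℝ) : ℂ))
        (𝕜 := ℂ) (fun z _ => hF.analyticAt z) (fun z _ => hG.analyticAt z)
      have : {s : ℂ | ‖x‖ < s.re} ∈ 𝓝 (((‖x‖ + 1 : ℝ) : ℂ)) :=
        (isOpen_lt continuous_const Complex.continuous_re).mem_nhds (by
          change ‖x‖ < ((‖x‖ + 1 : ℝ) : ℂ).re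
          rw [Complex.ofReal_re]; linarith)
      filter_upwards [this] with s hs
      change N (fun _ => s • (1 : C(K, ℂ)) + x) = _
      rw [hNP]
      apply hpos
      intro t
      change 0 < (s * 1 + x t).re
      have h4 := (Complex.abs_re_le_norm (x t)).trans (x.norm_coe_le_norm t)
      have h5 := (abs_le.1 h4).1
      have hs : ‖x‖ < s.re := hs
      rw [mul_one, Complex.add_re]
      linarith
    have := congrFun hFG 0
    simp only [F, G, zero_smul, zero_add] at this
    rw [← this, hNP]
  have hp0 : 0 ≤ polyNorm P := by
    unfold polyNorm
    apply Real.sSup_nonneg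
    rintro _ ⟨y, _, rfl⟩
    positivity
  refine ⟨φ, hall, ?_⟩
  refine φ.opNorm_le_bound (by positivity) ?_
  have hposb : ∀ v : C(K, ℂ), (∀ t, 0 < (v t).re) → ‖φ v‖ ≤ polyNorm P * ‖v‖ := by
    intro v hv
    obtain ⟨X, hX⟩ := aux_log v hv
    have h1 : exC (((k + 1 : ℕ) : ℂ)⁻¹ • X) ^ (k + 1) = v := by
      rw [← hX]
      ext t
      change Complex.exp (((k + 1 : ℕ) : ℂ)⁻¹ * X t) ^ (k + 1) = Complex.exp (X t)
      rw [← Complex.exp_nat_mul, mul_inv_cancel_left₀]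
      exact_mod_cast Nat.succ_ne_zero k
    rw [← h1, ← hall]
    refine (hPle _).trans ?_
    exact mul_le_mul_of_nonneg_left (aux_norm_pow _ _) hp0
  intro y
  by_cases hy : y = 0
  · simp [hy]
  have hy0 : 0 < ‖y‖ := norm_pos_iff.2 hy
  have : Nonempty K := by
    by_contra h
    rw [not_nonempty_iff] at h
    exact hy (Subsingleton.elim _ _)
  have h2 := hposb (((2 * ‖y‖ : ℝ) : ℂ) • (1 : C(K, ℂ))) (fun t => by
    change 0 < (((2 * ‖y‖ : ℝ) : ℂ) * 1).re
    rw [mul_one, Complex.ofReal_re]; positivity)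
  have h3 := hposb (((2 * ‖y‖ : ℝ) : ℂ) • (1 : C(K, ℂ)) + y) (fun t => by
    change 0 < (((2 * ‖y‖ : ℝ) : ℂ) * 1 + y t).re
    have h4 := (Complex.abs_re_le_norm (y t)).trans (y.norm_coe_le_norm t)
    have h5 := (abs_le.1 h4).1
    rw [mul_one, Complex.add_re, Complex.ofReal_re]
    linarith)
  have h6 : ‖((2 * ‖y‖ : ℝ) : ℂ) • (1 : C(K, ℂ))‖ = 2 * ‖y‖ := by
    rw [norm_smul, Complex.norm_real, norm_one, mul_one, Real.norm_eq_abs, abs_of_pos (by positivity)]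
  rw [h6] at h2
  have h7 := norm_add_le (((2 * ‖y‖ : ℝ) : ℂ) • (1 : C(K, ℂ))) y
  rw [h6] at h7
  have h8 : φ y = φ (((2 * ‖y‖ : ℝ) : ℂ) • (1 : C(K, ℂ)) + y) - φ (((2 * ‖y‖ : ℝ) : ℂ) • (1 : C(K, ℂ))) := by
    rw [map_add]; ring
  rw [h8]
  refine (norm_sub_le _ _).trans ?_
  nlinarith [mul_le_mul_of_nonneg_left h7 hp0]

theorem aux_orthAdd {K : Type*} [TopologicalSpace K] [CompactSpace K]
    (f : C(K, ℂ) → ℂ) (P : ℕ → C(K, ℂ) → ℂ)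
    (hP : ∀ k, IsHomogPoly k (P k))
    (hf : ∀ x : C(K, ℂ), HasSum (fun k => P k x) (f x))
    (hOA : IsOrthAdd f) (k : ℕ) : IsOrthAdd (P k) := by
  intro x y hxy
  have hs : ∀ k (s : ℂ) (y : C(K, ℂ)), P k (s • y) = s ^ k * P k y := by
    intro k s y
    obtain ⟨M, hM⟩ := hP k
    rw [hM, hM, M.map_smul_univ (fun _ => s) (fun _ => y)]
    simp
  let a : ℕ → ℂ := fun k => P k (x + y) - P k x - P k y
  have h1 : ∀ s : ℂ, HasSum (fun k => s ^ k * a k) 0 := by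
    intro s
    have e := ((hf (s • (x + y))).sub (hf (s • x))).sub (hf (s • y))
    have e2 : f (s • (x + y)) - f (s • x) - f (s • y) = 0 := by
      rw [smul_add, hOA]
      · ring
      · rw [smul_mul_smul_comm, hxy, smul_zero]
    rw [e2] at e
    refine e.congr_fun (fun k => ?_)
    simp only [a]
    rw [hs, hs, hs]; ring
  have h2 : HasFPowerSeriesAt (fun _ : ℂ => (0 : ℂ)) (FormalMultilinearSeries.ofScalars ℂ a) 0 := by
    rw [hasFPowerSeriesAt_iff]
    filter_upwards with s
    simpa [FormalMultilinearSeries.coeff_ofScalars, mul_comm] using h1 s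
  have h3 := h2.eq_zero
  have h4 : (FormalMultilinearSeries.ofScalars ℂ a).coeff k = 0 := by rw [h3]; rfl
  rw [FormalMultilinearSeries.coeff_ofScalars] at h4
  have h5 : P k (x + y) - P k x - P k y = 0 := h4
  linear_combination h5

end

section
open MeasureTheory Filter Topology
open scoped NNReal

theorem aux_rieszPos {X : Type*} [TopologicalSpace X] [CompactSpace X] [T2Space X]
    [MeasurableSpace X] [BorelSpace X] (q : C(X, ℝ≥0) → ℝ) (h0 : ∀ f, 0 ≤ q f)
    (hadd : ∀ f g, q (f + g) = q f + q g) (hsmul : ∀ (c : ℝ≥0) f, q (c • f) = c * q f) :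
    ∃ μ : Measure X, IsFiniteMeasure μ ∧ ∀ f : C(X, ℝ≥0), q f = ∫ x, (f x : ℝ) ∂μ := by
  let L : CompactlySupportedContinuousMap X ℝ≥0 →ₗ[ℝ≥0] ℝ≥0 :=
    { toFun := fun f => ⟨q f.toContinuousMap, h0 _⟩
      map_add' := fun f g => by
        apply NNReal.coe_injective
        exact hadd f.toContinuousMap g.toContinuousMap
      map_smul' := fun c f => by
        apply NNReal.coe_injective
        exact hsmul c f.toContinuousMap }
  refine ⟨NNRealRMK.rieszMeasure L, ?_, ?_⟩
  · exact CompactSpace.isFiniteMeasure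
  · intro f
    have := NNRealRMK.integral_rieszMeasure L ⟨f, HasCompactSupport.of_compactSpace f⟩
    exact this.symm

noncomputable def nnC {X : Type*} [TopologicalSpace X] (f : C(X, ℝ≥0)) : C(X, ℂ) :=
  ⟨fun t => ((f t : ℝ) : ℂ), by fun_prop⟩

noncomputable def tvF {X : Type*} [TopologicalSpace X] [CompactSpace X]
    (Λ : C(X, ℂ) →L[ℂ] ℂ) (f : C(X, ℝ≥0)) : ℝ :=
  sSup {r | ∃ g : C(X, ℂ), (∀ t, ‖g t‖ ≤ f t) ∧ r = ‖Λ g‖}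

section
variable {X : Type*} [TopologicalSpace X] [CompactSpace X] (Λ : C(X, ℂ) →L[ℂ] ℂ)

theorem tv_le (f : C(X, ℝ≥0)) (B : ℝ) (h : ∀ g : C(X, ℂ), (∀ t, ‖g t‖ ≤ f t) → ‖Λ g‖ ≤ B) :
    tvF Λ f ≤ B := by
  apply csSup_le
  · exact ⟨_, 0, by simp, rfl⟩
  · rintro _ ⟨g, hg, rfl⟩
    exact h g hg

theorem le_tv (f : C(X, ℝ≥0)) (g : C(X, ℂ)) (h : ∀ t, ‖g t‖ ≤ f t) : ‖Λ g‖ ≤ tvF Λ f := by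
  apply le_csSup
  · refine ⟨‖Λ‖ * ‖nnC f‖, ?_⟩
    rintro _ ⟨g, hg, rfl⟩
    refine (Λ.le_opNorm g).trans ?_
    gcongr
    rw [ContinuousMap.norm_le _ (norm_nonneg _)]
    intro t
    refine (hg t).trans ?_
    have := (nnC f).norm_coe_le_norm t
    refine le_trans ?_ this
    change _ ≤ ‖((f t : ℝ) : ℂ)‖
    rw [Complex.norm_real]
    exact le_abs_self _
  · exact ⟨g, h, rfl⟩

theorem aux_phase (z : ℂ) : ∃ c : ℂ, ‖c‖ = 1 ∧ c * z = ‖z‖ := by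
  by_cases h : z = 0
  · exact ⟨1, by simp, by simp [h]⟩
  · refine ⟨‖z‖ / z, ?_, ?_⟩
    · simp [h]
    · field_simp

theorem tv_add (f₁ f₂ : C(X, ℝ≥0)) : tvF Λ (f₁ + f₂) = tvF Λ f₁ + tvF Λ f₂ := by
  apply le_antisymm
  · apply tv_le
    intro g hg
    have key : ∀ ε : ℝ, 0 < ε → ‖Λ g‖ ≤ tvF Λ f₁ + tvF Λ f₂ + ‖Λ‖ * ε := by
      intro ε hε
      have hpos : ∀ t, (0 : ℝ) < f₁ t + f₂ t + ε := fun t => by positivity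
      have hne : ∀ t, (((f₁ t : ℝ) : ℂ) + ((f₂ t : ℝ) : ℂ) + (ε : ℂ)) ≠ 0 := fun t => by
        exact_mod_cast (hpos t).ne'
      have hnorm : ∀ t, ‖(((f₁ t : ℝ) : ℂ) + ((f₂ t : ℝ) : ℂ) + (ε : ℂ))‖ = f₁ t + f₂ t + ε := fun t => by
        rw [← Complex.ofReal_add, ← Complex.ofReal_add, Complex.norm_real, Real.norm_eq_abs,
          abs_of_pos (hpos t)]
      have hg' : ∀ t, ‖g t‖ ≤ f₁ t + f₂ t := fun t => by simpa using hg t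
      let u : C(X, ℂ) := ⟨fun t => g t / (((f₁ t : ℝ) : ℂ) + ((f₂ t : ℝ) : ℂ) + (ε : ℂ)),
        Continuous.div (by fun_prop) (by fun_prop) hne⟩
      have hu : ∀ t, ‖u t‖ ≤ 1 := fun t => by
        change ‖g t / (((f₁ t : ℝ) : ℂ) + ((f₂ t : ℝ) : ℂ) + (ε : ℂ))‖ ≤ 1
        rw [norm_div, hnorm, div_le_one (hpos t)]
        linarith [hg' t]
      have hb : ∀ (f : C(X, ℝ≥0)) t, ‖(u * nnC f) t‖ ≤ f t := fun f t => by
        change ‖u t * ((f t : ℝ) : ℂ)‖ ≤ f t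
        rw [norm_mul, Complex.norm_real, Real.norm_eq_abs, abs_of_nonneg (NNReal.coe_nonneg _)]
        exact mul_le_of_le_one_left (NNReal.coe_nonneg _) (hu t)
      have hdec : g = u * nnC f₁ + u * nnC f₂ + (ε : ℂ) • u := by
        ext t
        change g t = g t / (((f₁ t : ℝ) : ℂ) + ((f₂ t : ℝ) : ℂ) + (ε : ℂ)) * ((f₁ t : ℝ) : ℂ)
          + g t / (((f₁ t : ℝ) : ℂ) + ((f₂ t : ℝ) : ℂ) + (ε : ℂ)) * ((f₂ t : ℝ) : ℂ)
          + (ε : ℂ) * (g t / (((f₁ t : ℝ) : ℂ) + ((f₂ t : ℝ) : ℂ) + (ε : ℂ)))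
        have := hne t
        field_simp
      have h3 : ‖Λ ((ε : ℂ) • u)‖ ≤ ‖Λ‖ * ε := by
        refine (Λ.le_opNorm _).trans ?_
        gcongr
        rw [norm_smul, Complex.norm_real, Real.norm_eq_abs, abs_of_pos hε]
        exact mul_le_of_le_one_right hε.le ((ContinuousMap.norm_le _ zero_le_one).2 hu)
      calc ‖Λ g‖ = ‖Λ (u * nnC f₁) + Λ (u * nnC f₂) + Λ ((ε : ℂ) • u)‖ := by
            rw [← map_add, ← map_add, ← hdec]
        _ ≤ ‖Λ (u * nnC f₁)‖ + ‖Λ (u * nnC f₂)‖ + ‖Λ ((ε : ℂ) • u)‖ := norm_add₃_le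
        _ ≤ _ := by
          gcongr
          · exact le_tv Λ f₁ _ (hb f₁)
          · exact le_tv Λ f₂ _ (hb f₂)
    have ht : Tendsto (fun ε : ℝ => tvF Λ f₁ + tvF Λ f₂ + ‖Λ‖ * ε) (𝓝[>] 0)
        (𝓝 (tvF Λ f₁ + tvF Λ f₂ + ‖Λ‖ * 0)) := by
      apply Tendsto.mono_left _ nhdsWithin_le_nhds
      apply Continuous.tendsto
      fun_prop
    rw [mul_zero, add_zero] at ht
    apply ge_of_tendsto ht
    filter_upwards [self_mem_nhdsWithin] with ε hε using key ε hε
  · rw [← le_sub_iff_add_le]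
    apply tv_le
    intro g₁ hg₁
    rw [le_sub_comm]
    apply tv_le
    intro g₂ hg₂
    rw [le_sub_iff_add_le]
    obtain ⟨c₁, hc₁, e₁⟩ := aux_phase (Λ g₁)
    obtain ⟨c₂, hc₂, e₂⟩ := aux_phase (Λ g₂)
    have h := le_tv Λ (f₁ + f₂) (c₁ • g₁ + c₂ • g₂) (fun t => by
      change ‖c₁ * g₁ t + c₂ * g₂ t‖ ≤ ((f₁ t + f₂ t : ℝ≥0) : ℝ)
      refine (norm_add_le _ _).trans ?_
      rw [norm_mul, norm_mul, hc₁, hc₂, one_mul, one_mul, NNReal.coe_add]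
      exact add_le_add (hg₁ t) (hg₂ t))
    rw [map_add, map_smul, map_smul, smul_eq_mul, smul_eq_mul, e₁, e₂, ← Complex.ofReal_add,
      Complex.norm_real, Real.norm_eq_abs, abs_of_nonneg (by positivity)] at h
    linarith

theorem tv_smul_le (c : ℝ≥0) (hc : 0 < c) (f : C(X, ℝ≥0)) : tvF Λ (c • f) ≤ c * tvF Λ f := by
  have hc' : (0 : ℝ) < c := hc
  apply tv_le
  intro g hg
  have h := le_tv Λ f (((c : ℝ) : ℂ)⁻¹ • g) (fun t => by
    change ‖((c : ℝ) : ℂ)⁻¹ * g t‖ ≤ _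
    rw [norm_mul, norm_inv, Complex.norm_real, Real.norm_eq_abs, abs_of_pos hc', inv_mul_le_iff₀ hc']
    exact hg t)
  rw [map_smul, norm_smul, norm_inv, Complex.norm_real, Real.norm_eq_abs, abs_of_pos hc',
    inv_mul_le_iff₀ hc'] at h
  exact h

theorem tv_smul (c : ℝ≥0) (f : C(X, ℝ≥0)) : tvF Λ (c • f) = c * tvF Λ f := by
  rcases eq_or_lt_of_le (show (0:ℝ≥0) ≤ c from bot_le) with rfl | hc
  · have := tv_add Λ 0 0
    rw [add_zero] at this
    simp only [zero_smul, NNReal.coe_zero, zero_mul]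
    linarith
  · apply le_antisymm (tv_smul_le Λ c hc f)
    have h := tv_smul_le Λ c⁻¹ (by positivity) (c • f)
    rw [smul_smul, inv_mul_cancel₀ hc.ne', one_smul] at h
    have hc' : (0 : ℝ) < c := hc
    rw [NNReal.coe_inv, le_inv_mul_iff₀ hc'] at h
    exact h

theorem norm_nnC_le (f : C(X, ℝ≥0)) : ‖Λ (nnC f)‖ ≤ tvF Λ f := by
  apply le_tv
  intro t
  change ‖((f t : ℝ) : ℂ)‖ ≤ _
  rw [Complex.norm_real, Real.norm_eq_abs, abs_of_nonneg (NNReal.coe_nonneg _)]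

end

theorem nnC_add {X : Type*} [TopologicalSpace X] (f g : C(X, ℝ≥0)) : nnC (f + g) = nnC f + nnC g := by
  ext t; simp [nnC]

theorem nnC_smul {X : Type*} [TopologicalSpace X] (c : ℝ≥0) (f : C(X, ℝ≥0)) :
    nnC (c • f) = ((c : ℝ) : ℂ) • nnC f := by
  ext t; simp [nnC]

theorem nnC_decomp {X : Type*} [TopologicalSpace X] (G : C(X, ℂ)) :
    ∃ a b c d : C(X, ℝ≥0), G = nnC a + (-1 : ℂ) • nnC b + Complex.I • nnC c + (-Complex.I) • nnC d := by
  refine ⟨⟨fun t => (G t).re.toNNReal, by fun_prop⟩, ⟨fun t => (-(G t).re).toNNReal, by fun_prop⟩,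
    ⟨fun t => (G t).im.toNNReal, by fun_prop⟩, ⟨fun t => (-(G t).im).toNNReal, by fun_prop⟩, ?_⟩
  ext t
  have h : ∀ r : ℝ, (r : ℂ) = ((r.toNNReal : ℝ) : ℂ) - (((-r).toNNReal : ℝ) : ℂ) := by
    intro r
    rw [← Complex.ofReal_sub]
    congr 1
    rw [Real.coe_toNNReal', Real.coe_toNNReal']
    grind
  change G t = (((G t).re.toNNReal : ℝ) : ℂ) + (-1) * (((-(G t).re).toNNReal : ℝ) : ℂ)
    + Complex.I * (((G t).im.toNNReal : ℝ) : ℂ) + (-Complex.I) * (((-(G t).im).toNNReal : ℝ) : ℂ)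
  conv_lhs => rw [← Complex.re_add_im (G t), h (G t).re, h (G t).im]
  ring

noncomputable def intL {X : Type*} [TopologicalSpace X] [CompactSpace X]
    [MeasurableSpace X] [BorelSpace X] (μ : Measure X) [IsFiniteMeasure μ] : C(X, ℂ) →ₗ[ℂ] ℂ where
  toFun G := ∫ x, G x ∂μ
  map_add' F G := by
    have h : ∀ F : C(X, ℂ), Integrable F μ := fun F =>
      F.continuous.integrable_of_hasCompactSupport (HasCompactSupport.of_compactSpace _)
    exact integral_add (h F) (h G)
  map_smul' c F := integral_const_mul c _

theorem aux_riesz {X : Type*} [TopologicalSpace X] [CompactSpace X] [T2Space X]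
    [MeasurableSpace X] [BorelSpace X] (Λ : C(X, ℂ) →L[ℂ] ℂ) :
    ∃ (ν : Measure X) (w : X → ℂ), IsFiniteMeasure ν ∧ Measurable w ∧ (∀ t, ‖w t‖ = 1) ∧
      ∀ G : C(X, ℂ), Λ G = ∫ x, G x * w x ∂ν := by
  obtain ⟨μ0, hf0, h0⟩ := aux_rieszPos (tvF Λ) (fun f => (norm_nonneg _).trans (norm_nnC_le Λ f))
    (tv_add Λ) (tv_smul Λ)
  obtain ⟨μ1, hf1, h1⟩ := aux_rieszPos (fun f => tvF Λ f - (Λ (nnC f)).re)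
    (fun f => sub_nonneg.2 ((Complex.re_le_norm _).trans (norm_nnC_le Λ f)))
    (fun f g => by simp only [tv_add, nnC_add, map_add, Complex.add_re]; ring)
    (fun c f => by
      simp only [tv_smul, nnC_smul, map_smul, smul_eq_mul, Complex.re_ofReal_mul]; ring)
  obtain ⟨μ2, hf2, h2⟩ := aux_rieszPos (fun f => tvF Λ f - (Λ (nnC f)).im)
    (fun f => sub_nonneg.2 (((le_abs_self _).trans (Complex.abs_im_le_norm _)).trans (norm_nnC_le Λ f)))
    (fun f g => by simp only [tv_add, nnC_add, map_add, Complex.add_im]; ring)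
    (fun c f => by
      simp only [tv_smul, nnC_smul, map_smul, smul_eq_mul, Complex.im_ofReal_mul]; ring)
  let J : C(X, ℂ) →ₗ[ℂ] ℂ := (1 + Complex.I) • intL μ0 - intL μ1 - Complex.I • intL μ2
  have hJa : ∀ G, J G = (1 + Complex.I) * (∫ x, G x ∂μ0) - (∫ x, G x ∂μ1) - Complex.I * ∫ x, G x ∂μ2 :=
    fun G => rfl
  have hJ0 : ∀ f, Λ (nnC f) = J (nnC f) := by
    intro f
    have e : ∀ μ : Measure X, ∫ x, nnC f x ∂μ = ((∫ x, (f x : ℝ) ∂μ : ℝ) : ℂ) := fun μ =>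
      integral_ofReal (f := fun x => (f x : ℝ))
    rw [hJa, e, e, e, ← h0, ← h1, ← h2]
    conv_lhs => rw [← Complex.re_add_im (Λ (nnC f))]
    push_cast
    ring
  have hJ : ∀ G, Λ G = J G := by
    intro G
    obtain ⟨a, b, c, d, rfl⟩ := nnC_decomp G
    simp only [map_add, map_smul, hJ0]
  let ν0 : Measure X := μ0 + μ1 + μ2
  have a0 : μ0 ≪ ν0 := Measure.AbsolutelyContinuous.rfl.add_right μ1 |>.add_right μ2
  have a1 : μ1 ≪ ν0 := by
    refine Measure.AbsolutelyContinuous.add_right ?_ μ2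
    rw [add_comm]
    exact Measure.AbsolutelyContinuous.rfl.add_right μ0
  have a2 : μ2 ≪ ν0 := by
    change μ2 ≪ μ0 + μ1 + μ2
    rw [add_comm]
    exact Measure.AbsolutelyContinuous.rfl.add_right _
  let r : Measure X → X → ℂ := fun μ x => (((μ.rnDeriv ν0 x).toReal : ℝ) : ℂ)
  have hrm : ∀ μ : Measure X, Measurable (r μ) := fun μ =>
    Complex.measurable_ofReal.comp (Measure.measurable_rnDeriv μ ν0).ennreal_toReal
  have hri : ∀ μ : Measure X, [IsFiniteMeasure μ] → Integrable (r μ) ν0 := fun μ _ =>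
    Measure.integrable_toReal_rnDeriv.ofReal
  have hint : ∀ μ : Measure X, [IsFiniteMeasure μ] → μ ≪ ν0 → ∀ G : C(X, ℂ),
      ∫ x, G x ∂μ = ∫ x, r μ x * G x ∂ν0 := by
    intro μ _ hμ G
    rw [← integral_rnDeriv_smul hμ]
    rfl
  let h : X → ℂ := fun x => (1 + Complex.I) * r μ0 x - r μ1 x - Complex.I * r μ2 x
  have hm : Measurable h := by
    have := hrm μ0; have := hrm μ1; have := hrm μ2
    fun_prop
  have hi : Integrable h ν0 := (((hri μ0).const_mul _).sub (hri μ1)).sub ((hri μ2).const_mul _)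
  have hLh : ∀ G : C(X, ℂ), Λ G = ∫ x, h x * G x ∂ν0 := by
    intro G
    have hG : ∀ μ : Measure X, [IsFiniteMeasure μ] → Integrable (fun x => r μ x * G x) ν0 := by
      intro μ _
      refine (hri μ).mul_bdd (c := ‖G‖) G.continuous.aestronglyMeasurable ?_
      exact Eventually.of_forall (fun x => G.norm_coe_le_norm x)
    have hsub : Integrable (fun x => (1 + Complex.I) * (r μ0 x * G x) - r μ1 x * G x) ν0 :=
      ((hG μ0).const_mul _).sub (hG μ1)
    rw [hJ, hJa, hint μ0 a0, hint μ1 a1, hint μ2 a2, ← integral_const_mul, ← integral_const_mul,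
      ← integral_sub ((hG μ0).const_mul _) (hG μ1),
      ← integral_sub hsub ((hG μ2).const_mul _)]
    apply integral_congr_ae
    filter_upwards with x
    simp only [h]
    ring
  have hms : MeasurableSet {x | h x = 0} := hm (measurableSet_singleton 0)
  classical
  refine ⟨ν0.withDensity (fun x => (‖h x‖₊ : ENNReal)), fun x => if h x = 0 then 1 else h x / ‖h x‖,
    ?_, ?_, ?_, ?_⟩
  · apply isFiniteMeasure_withDensity
    exact hi.2.ne
  · apply Measurable.ite hms measurable_const
    exact hm.div (Complex.measurable_ofReal.comp hm.norm)
  · intro x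
    by_cases hx : h x = 0
    · simp [hx]
    · simp [hx]
  · intro G
    rw [hLh, integral_withDensity_eq_integral_smul hm.nnnorm]
    apply integral_congr_ae
    filter_upwards with x
    change _ = ((‖h x‖ : ℝ) : ℂ) * _
    by_cases hx : h x = 0
    · simp [hx]
    · have : ((‖h x‖ : ℝ) : ℂ) ≠ 0 := by simpa using hx
      simp only [hx, if_false]
      field_simp

end

section
open MeasureTheory Filter Topology

instance aux_borel (K : Type*) [TopologicalSpace K] [CompactSpace K] : BorelSpace (DualBall K) := ⟨rfl⟩

instance aux_cpt (K : Type*) [TopologicalSpace K] [CompactSpace K] : CompactSpace (DualBall K) := by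
  have h := WeakDual.isCompact_closedBall (𝕜 := ℂ) (E := C(K, ℂ)) 0 1
  have e : (WeakDual.toStrongDual ⁻¹' Metric.closedBall (0 : StrongDual ℂ C(K, ℂ)) 1) =
      {γ : WeakDual ℂ C(K, ℂ) | ∀ x : C(K, ℂ), ‖γ x‖ ≤ ‖x‖} := by
    ext γ
    simp only [Set.mem_preimage, mem_closedBall_zero_iff, Set.mem_setOf_eq]
    constructor
    · intro hγ x
      have := (WeakDual.toStrongDual γ).le_of_opNorm_le hγ x
      simpa using this
    · intro hγ
      exact ContinuousLinearMap.opNorm_le_bound _ zero_le_one (fun x => by simpa using hγ x)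
  rw [e] at h
  exact isCompact_iff_compactSpace.mp h

noncomputable def evB {K : Type*} [TopologicalSpace K] [CompactSpace K] (x : C(K, ℂ)) :
    C(DualBall K, ℂ) :=
  ⟨fun γ => γ.1 x, (WeakDual.eval_continuous x).comp continuous_subtype_val⟩

noncomputable def iotaB (K : Type*) [TopologicalSpace K] [CompactSpace K] :
    C(ℝ × K, DualBall K) where
  toFun p := ⟨StrongDual.toWeakDual
      ((Complex.exp (p.1 * Complex.I)) • (ContinuousMap.evalCLM ℂ p.2 : C(K, ℂ) →L[ℂ] ℂ)), by
    intro x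
    change ‖Complex.exp (p.1 * Complex.I) * x p.2‖ ≤ _
    rw [norm_mul, Complex.norm_exp_ofReal_mul_I, one_mul]
    exact x.norm_coe_le_norm _⟩
  continuous_toFun := by
    refine Continuous.subtype_mk ?_ _
    apply WeakDual.continuous_of_continuous_eval
    intro x
    change Continuous (fun p : ℝ × K => Complex.exp (p.1 * Complex.I) * x p.2)
    fun_prop

theorem aux_T {K : Type*} [TopologicalSpace K] [CompactSpace K] (φ : C(K, ℂ) →L[ℂ] ℂ) (k : ℕ) :
    ∃ S : C(DualBall K, ℂ) →L[ℂ] ℂ, ‖S‖ ≤ ‖φ‖ ∧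
      ∀ x j, S (evB x ^ j) = if j = k then φ (x ^ k) else 0 := by
  let cur : C(DualBall K, ℂ) → C(ℝ, C(K, ℂ)) := fun G => (G.comp (iotaB K)).curry
  let F : C(DualBall K, ℂ) → ℝ → ℂ := fun G θ =>
    Complex.exp (-(k * θ * Complex.I)) * φ (cur G θ)
  have hFc : ∀ G, Continuous (F G) := by
    intro G
    have : Continuous fun θ => φ (cur G θ) := φ.continuous.comp (cur G).continuous
    fun_prop
  have hFb : ∀ G θ, ‖F G θ‖ ≤ ‖φ‖ * ‖G‖ := by
    intro G θ
    have h1 : ‖Complex.exp (-(k * θ * Complex.I))‖ = 1 := by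
      rw [show (-(k * θ * Complex.I) : ℂ) = ((-(k * θ) : ℝ) : ℂ) * Complex.I by push_cast; ring,
        Complex.norm_exp_ofReal_mul_I]
    simp only [F]
    rw [norm_mul, h1, one_mul]
    refine φ.le_opNorm_of_le ?_
    rw [ContinuousMap.norm_le _ (norm_nonneg _)]
    intro t
    exact G.norm_coe_le_norm _
  let S0 : C(DualBall K, ℂ) →ₗ[ℂ] ℂ :=
    { toFun := fun G => ((2 * Real.pi : ℝ) : ℂ)⁻¹ * ∫ θ in (0:ℝ)..(2 * Real.pi), F G θ
      map_add' := by
        intro G H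
        have : F (G + H) = fun θ => F G θ + F H θ := by
          ext θ
          have : cur (G + H) θ = cur G θ + cur H θ := by ext; rfl
          simp only [F, this, map_add, mul_add]
        rw [this, intervalIntegral.integral_add ((hFc G).intervalIntegrable _ _)
          ((hFc H).intervalIntegrable _ _), mul_add]
      map_smul' := by
        intro c G
        have : F (c • G) = fun θ => c * F G θ := by
          ext θ
          have : cur (c • G) θ = c • cur G θ := by ext; rfl
          simp only [F, this, map_smul, smul_eq_mul]
          ring
        rw [this, intervalIntegral.integral_const_mul]
        simp only [RingHom.id_apply, smul_eq_mul]
        ring }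
  have hpi : (0:ℝ) < 2 * Real.pi := by positivity
  have hS0 : ∀ G, ‖S0 G‖ ≤ ‖φ‖ * ‖G‖ := by
    intro G
    change ‖((2 * Real.pi : ℝ) : ℂ)⁻¹ * ∫ θ in (0:ℝ)..(2 * Real.pi), F G θ‖ ≤ _
    have := intervalIntegral.norm_integral_le_of_norm_le_const (a := 0) (b := 2 * Real.pi)
      (f := F G) (C := ‖φ‖ * ‖G‖) (fun θ _ => hFb G θ)
    rw [norm_mul, norm_inv, Complex.norm_real, Real.norm_eq_abs, abs_of_pos hpi,
      inv_mul_le_iff₀ hpi]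
    rw [sub_zero, abs_of_pos hpi] at this
    linarith
  refine ⟨S0.mkContinuous ‖φ‖ hS0, LinearMap.mkContinuous_norm_le _ (norm_nonneg _) _, ?_⟩
  intro x j
  change ((2 * Real.pi : ℝ) : ℂ)⁻¹ * ∫ θ in (0:ℝ)..(2 * Real.pi), F (evB x ^ j) θ = _
  have hF : F (evB x ^ j) = fun θ : ℝ =>
      Complex.exp ((((j : ℂ) - k) * Complex.I) * θ) * φ (x ^ j) := by
    ext θ
    have : cur (evB x ^ j) θ = Complex.exp (j * (θ * Complex.I)) • x ^ j := by
      ext t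
      change (Complex.exp (θ * Complex.I) * x t) ^ j = Complex.exp (j * (θ * Complex.I)) * (x t) ^ j
      rw [mul_pow, ← Complex.exp_nat_mul]
    simp only [F, this, map_smul, smul_eq_mul]
    rw [← mul_assoc, ← Complex.exp_add]
    congr 2
    ring
  rw [hF, intervalIntegral.integral_mul_const]
  have hpc : ((2 * Real.pi : ℝ) : ℂ) ≠ 0 := by exact_mod_cast hpi.ne'
  by_cases hjk : j = k
  · subst hjk
    simp only [sub_self, zero_mul, Complex.exp_zero, if_true, intervalIntegral.integral_const,
      sub_zero]
    rw [Complex.real_smul, mul_one, ← mul_assoc, inv_mul_cancel₀ hpc, one_mul]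
  · have hc : ((j : ℂ) - k) * Complex.I ≠ 0 := by
      apply mul_ne_zero _ Complex.I_ne_zero
      rw [sub_ne_zero]
      exact_mod_cast hjk
    rw [integral_exp_mul_complex hc, if_neg hjk]
    have : Complex.exp (((j : ℂ) - k) * Complex.I * ((2 * Real.pi : ℝ) : ℂ)) = 1 := by
      rw [Complex.exp_eq_one_iff]
      exact ⟨(j : ℤ) - k, by push_cast; ring⟩
    rw [this]
    simp

theorem aux_final
    {K : Type*} [TopologicalSpace K] [CompactSpace K] [T2Space K]
    (f : C(K, ℂ) → ℂ) (P : ℕ → C(K, ℂ) → ℂ)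
    (hP : ∀ k, IsHomogPoly k (P k))
    (hf : ∀ x : C(K, ℂ), HasSum (fun k => P k x) (f x))
    (hb : ∀ r : ℝ, 0 < r → Summable (fun k => polyNorm (P k) * r ^ k))
    (hOA : IsOrthAdd f) :
    ∀ n : ℕ, 1 ≤ n →
      ∃ (ν : Measure (DualBall K)) (w : DualBall K → ℂ),
        IsFiniteMeasure ν ∧ Measurable w ∧ (∀ γ, ‖w γ‖ = 1) ∧
        ∀ x : C(K, ℂ), ‖x‖ < n →
          f x = ∫ γ, (1 - γ.1 x / (n : ℂ))⁻¹ * w γ ∂ν := by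
  intro n hn
  have hn0 : (0 : ℝ) < n := by exact_mod_cast hn
  have hnc : (n : ℂ) ≠ 0 := by exact_mod_cast hn0.ne'
  have hPO : ∀ k, IsOrthAdd (P k) := aux_orthAdd f P hP hf hOA
  have hφ : ∀ k, ∃ φ : C(K, ℂ) →L[ℂ] ℂ, (∀ x, P k x = φ (x ^ k)) ∧ ‖φ‖ ≤ 5 * polyNorm (P k) := by
    intro k
    cases k with
    | succ k => exact aux_repr _ (hP _) (hPO _)
    | zero =>
      obtain ⟨M, hM⟩ := hP 0
      have hc : ∀ x, P 0 x = P 0 0 := by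
        intro x
        rw [hM, hM]
        congr 1
        ext i
        exact i.elim0
      have h0 := hPO 0 0 0 (by simp)
      rw [add_zero] at h0
      have h1 : P 0 0 = 0 := by simpa using h0
      refine ⟨0, fun x => by rw [hc, h1]; simp, ?_⟩
      have : 0 ≤ polyNorm (P 0) := by
        apply Real.sSup_nonneg
        rintro _ ⟨x, _, rfl⟩
        exact norm_nonneg _
      simpa using this
  choose φ hφ1 hφ2 using hφ
  choose S hS1 hS2 using fun k => aux_T (φ k) k
  have hsum : Summable (fun k => (n : ℂ) ^ k • S k) := by
    apply Summable.of_norm_bounded (g := fun k => 5 * (polyNorm (P k) * (n : ℝ) ^ k))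
      ((hb n hn0).mul_left 5)
    intro k
    rw [norm_smul, norm_pow, Complex.norm_natCast]
    calc (n : ℝ) ^ k * ‖S k‖ ≤ (n : ℝ) ^ k * (5 * polyNorm (P k)) := by
          gcongr
          exact (hS1 k).trans (hφ2 k)
      _ = _ := by ring
  set Λ : C(DualBall K, ℂ) →L[ℂ] ℂ := ∑' k, (n : ℂ) ^ k • S k with hΛ
  have hΛe : ∀ x j, Λ (evB x ^ j) = (n : ℂ) ^ j * P j x := by
    intro x j
    have h1 : HasSum (fun k => ((n : ℂ) ^ k • S k) (evB x ^ j)) (Λ (evB x ^ j)) :=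
      hsum.hasSum.mapL (ContinuousLinearMap.apply ℂ ℂ (evB x ^ j))
    have h2 := hasSum_single (f := fun k => ((n : ℂ) ^ k • S k) (evB x ^ j)) j (by
      intro k hk
      change (n : ℂ) ^ k * S k (evB x ^ j) = 0
      rw [hS2, if_neg (Ne.symm hk), mul_zero])
    rw [h1.unique h2]
    change (n : ℂ) ^ j * S j (evB x ^ j) = _
    rw [hS2, if_pos rfl, hφ1]
  obtain ⟨ν, w, hν, hw, hw1, hr⟩ := aux_riesz Λ
  refine ⟨ν, w, hν, hw, hw1, ?_⟩
  intro x hx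
  let e : C(DualBall K, ℂ) := (n : ℂ)⁻¹ • evB x
  have he : ‖e‖ < 1 := by
    have : ‖evB x‖ ≤ ‖x‖ := by
      rw [ContinuousMap.norm_le _ (norm_nonneg _)]
      exact fun γ => γ.2 x
    calc ‖e‖ ≤ (n : ℝ)⁻¹ * ‖x‖ := by
          simp only [e]
          rw [norm_smul, norm_inv, Complex.norm_natCast]
          gcongr
      _ < 1 := by
          rw [inv_mul_lt_iff₀ hn0]; simpa using hx
  have hg : HasSum (fun j => e ^ j) (∑' j, e ^ j) :=
    (summable_geometric_of_norm_lt_one he).hasSum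
  have hG : ∀ γ : DualBall K, (∑' j, e ^ j) γ = (1 - γ.1 x / (n : ℂ))⁻¹ := by
    intro γ
    have h := congrArg (fun g : C(DualBall K, ℂ) => g γ) (geom_series_mul_neg e he)
    change (∑' j, e ^ j : C(DualBall K, ℂ)) γ * (1 - (n : ℂ)⁻¹ * γ.1 x) = 1 at h
    rw [div_eq_inv_mul]
    exact eq_inv_of_mul_eq_one_left h
  have h1 : HasSum (fun j => Λ (e ^ j)) (Λ (∑' j, e ^ j)) := hg.mapL Λ
  have h2 : (fun j => Λ (e ^ j)) = fun j => P j x := by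
    ext j
    simp only [e]
    rw [smul_pow, map_smul, hΛe, smul_eq_mul, ← mul_assoc, ← mul_pow, inv_mul_cancel₀ hnc, one_pow,
      one_mul]
  rw [h2] at h1
  rw [(hf x).unique h1, hr]
  simp only [hG]

end

/-- An orthogonally additive holomorphic function of bounded type on `C(K)`
(given by its Taylor series `f = ∑ₖ Pₖ` at `0`, with `∑ₖ ‖Pₖ‖ rᵏ < ∞` for all
`r > 0`) is integral on every ball: for each `n ≥ 1` there is a complex Borel
measure (in polar form `w · ν`) on the weak-* dual unit ball representing `f`
on the open ball of radius `n`. -/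
theorem orthAdd_boundedType_integral
    {K : Type*} [TopologicalSpace K] [CompactSpace K] [T2Space K]
    (f : C(K, ℂ) → ℂ) (P : ℕ → C(K, ℂ) → ℂ)
    (hP : ∀ k, IsHomogPoly k (P k))
    (hf : ∀ x : C(K, ℂ), HasSum (fun k => P k x) (f x))
    (hb : ∀ r : ℝ, 0 < r → Summable (fun k => polyNorm (P k) * r ^ k))
    (hOA : IsOrthAdd f) :
    ∀ n : ℕ, 1 ≤ n →
      ∃ (ν : Measure (DualBall K)) (w : DualBall K → ℂ),
        IsFiniteMeasure ν ∧ Measurable w ∧ (∀ γ, ‖w γ‖ = 1) ∧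
        ∀ x : C(K, ℂ), ‖x‖ < n →
          f x = ∫ γ, (1 - γ.1 x / (n : ℂ))⁻¹ * w γ ∂ν := by
  exact aux_final f P hP hf hb hOA
end

section
/- Let K be a compact Hausdorff space, k ≥ 1, and let P be an orthogonally additive continuous k-homogeneous polynomial on C(K). Then P is integral: there exists a complex Borel measure ν on the closed unit ball B' of the dual of C(K), equipped with the weak-* topology, such that P(x) = ∫_{B'} γ(x)^k dν(γ) for all x ∈ C(K). -/
open MeasureTheory Filter Topology

namespace OrthAddAux

theorem sign_avg {E : Type*} [AddCommGroup E] [Module ℂ E]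
    (B : E → E → ℂ) (hl : ∀ x y z, B (x + y) z = B x z + B y z)
    (hr : ∀ x y z, B x (y + z) = B x y + B x z)
    (hn : ∀ x y, B (-x) y = - B x y) (hn' : ∀ x y, B x (-y) = - B x y) (a b : ℕ → E) (R : ℝ) (n : ℕ) :
    ∀ A₀ B₀ : E, (∀ e : ℕ → ℝ, (∀ i, |e i| = 1) →
      ‖B (A₀ + ∑ i ∈ Finset.range n, (e i : ℂ) • a i)
        (B₀ + ∑ i ∈ Finset.range n, (e i : ℂ) • b i)‖ ≤ R) →
    ‖B A₀ B₀ + ∑ i ∈ Finset.range n, B (a i) (b i)‖ ≤ R := by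
  induction n with
  | zero =>
    intro A₀ B₀ h
    simpa using h (fun _ => 1) (by simp)
  | succ n ih =>
    intro A₀ B₀ h
    have key : ∀ s : ℝ, |s| = 1 →
        ‖B (A₀ + (s : ℂ) • a n) (B₀ + (s : ℂ) • b n) + ∑ i ∈ Finset.range n, B (a i) (b i)‖ ≤ R := by
      intro s hs
      apply ih
      intro e he
      have := h (Function.update e n s) (by
        intro i
        by_cases hi : i = n
        · subst hi; simpa using hs
        · simpa [hi] using he i)
      rw [Finset.sum_range_succ, Finset.sum_range_succ] at this
      have e1 : ∀ c : ℕ → E, ∑ i ∈ Finset.range n, ((Function.update e n s i : ℝ) : ℂ) • c i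
          = ∑ i ∈ Finset.range n, (e i : ℂ) • c i := by
        intro c
        apply Finset.sum_congr rfl
        intro i hi
        have : i ≠ n := by simp at hi; omega
        simp [this]
      rw [e1, e1] at this
      simp only [Function.update_self] at this
      convert this using 3 <;> abel
    have h1 := key 1 (by simp)
    have h2 := key (-1) (by simp)
    simp only [Complex.ofReal_one, one_smul, Complex.ofReal_neg, neg_smul, hl, hr, hn, hn', neg_neg] at h1 h2
    rw [Finset.sum_range_succ]
    set S := ∑ i ∈ Finset.range n, B (a i) (b i)
    have h3 : B A₀ B₀ + (S + B (a n) (b n)) = (1/2 : ℂ) *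
      ((B A₀ B₀ + B A₀ (b n) + (B (a n) B₀ + B (a n) (b n)) + S) +
       (B A₀ B₀ + -B A₀ (b n) + (-B (a n) B₀ + B (a n) (b n)) + S)) := by ring
    rw [h3, norm_mul]
    have h4 := norm_add_le (B A₀ B₀ + B A₀ (b n) + (B (a n) B₀ + B (a n) (b n)) + S)
       (B A₀ B₀ + -B A₀ (b n) + (-B (a n) B₀ + B (a n) (b n)) + S)
    have h5 : ‖(1/2:ℂ)‖ = 1/2 := by norm_num
    rw [h5]
    linarith [h1, h2]

theorem adj_sum (f : ℕ → ℕ → ℂ) (h0 : ∀ i, f i i = 0)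
    (h1 : ∀ i j, i + 2 ≤ j → f i j = 0) (h2 : ∀ i j, i + 2 ≤ j → f j i = 0) (n : ℕ) :
    ∑ i ∈ Finset.range (n+1), ∑ j ∈ Finset.range (n+1), f i j
      = ∑ i ∈ Finset.range n, f (i+1) i + ∑ i ∈ Finset.range n, f i (i+1) := by
  induction n with
  | zero => simp [h0]
  | succ n ih =>
    rw [Finset.sum_range_succ]
    simp_rw [Finset.sum_range_succ _ (n+1)]
    rw [Finset.sum_add_distrib, ih, h0, Finset.sum_range_succ (fun i => f (i+1) i) n,
      Finset.sum_range_succ (fun i => f i (i+1)) n]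
    rw [Finset.sum_range_succ (fun i => f i (n+1)) n, Finset.sum_range_succ (fun i => f (n+1) i) n]
    rw [Finset.sum_eq_zero (s := Finset.range n) (f := fun i => f i (n+1)),
      Finset.sum_eq_zero (s := Finset.range n) (f := fun i => f (n+1) i)]
    · ring
    · intro i hi; simp at hi; exact h2 _ _ (by omega)
    · intro i hi; simp at hi; exact h1 _ _ (by omega)

/-- clamp -/
noncomputable def cl (s : ℝ) : ℝ := max 0 (min 1 s)

noncomputable def hat (i : ℕ) (s : ℝ) : ℝ := cl (s - i) - cl (s - (i + 1 : ℕ))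

theorem cl_cont : Continuous cl := by unfold cl; fun_prop
theorem hat_cont (i : ℕ) : Continuous (hat i) := by
  have := cl_cont
  unfold hat; fun_prop

theorem cl_mono : Monotone cl := by
  intro a b h; unfold cl; gcongr

theorem hat_nonneg (i : ℕ) (s : ℝ) : 0 ≤ hat i s := by
  unfold hat
  have := @cl_mono (s - (i+1:ℕ)) (s - i) (by push_cast; linarith)
  linarith

theorem cl_nonneg (s : ℝ) : 0 ≤ cl s := le_max_left _ _
theorem cl_le (s : ℝ) : cl s ≤ 1 := max_le zero_le_one (min_le_left _ _)
theorem cl_one {s : ℝ} (h : 1 ≤ s) : cl s = 1 := by simp [cl, h]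
theorem cl_zero {s : ℝ} (h : s ≤ 0) : cl s = 0 := by
  rw [cl, max_eq_left]; exact (min_le_right _ _).trans h

theorem hat_left (i : ℕ) {s : ℝ} (h : s ≤ i) : hat i s = 0 := by
  rw [hat, cl_zero (by linarith), cl_zero (by push_cast; linarith)]; simp
theorem hat_right (i : ℕ) {s : ℝ} (h : i + 2 ≤ s) : hat i s = 0 := by
  rw [hat, cl_one (by linarith), cl_one (by push_cast; linarith)]; simp

theorem hat_sum (n m : ℕ) (s : ℝ) :
    ∑ i ∈ Finset.range n, hat (i + m) s = cl (s - m) - cl (s - (n + m : ℕ)) := by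
  induction n with
  | zero => simp
  | succ n ih => rw [Finset.sum_range_succ, ih, hat]; push_cast; ring_nf

theorem hat_sum_le (n m : ℕ) (s : ℝ) : ∑ i ∈ Finset.range n, hat (i + m) s ≤ 1 := by
  rw [hat_sum]; linarith [cl_le (s - m), cl_nonneg (s - (n + m : ℕ))]

variable {K : Type*} [TopologicalSpace K] [CompactSpace K]

noncomputable def hatf (Y : C(K, ℝ)) (i : ℕ) : C(K, ℂ) :=
  ⟨fun t => (hat i (Y t) : ℂ), by have := hat_cont i; fun_prop⟩

theorem hatf_apply (Y : C(K, ℝ)) (i : ℕ) (t : K) : hatf Y i t = (hat i (Y t) : ℂ) := rfl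

theorem hatf_orth (Y : C(K, ℝ)) {i j : ℕ} (h : i + 2 ≤ j) : hatf Y i * hatf Y j = 0 := by
  ext t
  simp only [ContinuousMap.mul_apply, hatf_apply, ContinuousMap.zero_apply]
  rcases le_total (Y t) j with h1 | h1
  · rw [hat_left j h1]; simp
  · have : (i:ℝ) + 2 ≤ j := by exact_mod_cast h
    rw [hat_right i (by linarith)]; simp

theorem hatf_signs (Y : C(K, ℝ)) (n m : ℕ) (e : ℕ → ℝ) (he : ∀ i, |e i| = 1) (x : C(K, ℂ)) :
    ‖∑ i ∈ Finset.range n, (e i : ℂ) • (x * hatf Y (i + m))‖ ≤ ‖x‖ := by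
  rw [ContinuousMap.norm_le _ (norm_nonneg _)]
  intro t
  rw [ContinuousMap.sum_apply]
  refine (norm_sum_le _ _).trans ?_
  have : ∀ i ∈ Finset.range n, ‖((e i : ℂ) • (x * hatf Y (i + m))) t‖ = ‖x t‖ * hat (i+m) (Y t) := by
    intro i _
    simp [hatf_apply, he i, abs_of_nonneg (hat_nonneg _ _)]
  rw [Finset.sum_congr rfl this, ← Finset.mul_sum]
  calc _ ≤ ‖x t‖ * 1 := by gcongr; exact hat_sum_le _ _ _
    _ ≤ ‖x‖ := by rw [mul_one]; exact x.norm_coe_le_norm t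

noncomputable def ofRe (Y : C(K, ℝ)) : C(K, ℂ) := ⟨fun t => (Y t : ℂ), by fun_prop⟩

theorem bilin_bound (B : C(K, ℂ) →L[ℂ] C(K, ℂ) →L[ℂ] ℂ)
    (hB : ∀ x y, x * y = 0 → B x y = 0) (Y : C(K, ℝ)) (N : ℕ) (h1 : ∀ t, 1 ≤ Y t)
    (h2 : ∀ t, Y t ≤ N) (x z : C(K, ℂ)) :
    ‖B (x * ofRe Y) z - B x (z * ofRe Y)‖ ≤ 6 * (‖B‖ * ‖x‖ * ‖z‖) := by
  have hBn : ∀ (a b : C(K, ℂ)) (r s : ℝ), ‖a‖ ≤ r → ‖b‖ ≤ s → ‖B a b‖ ≤ ‖B‖ * r * s := by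
    intro a b r s ha hb
    refine (B.le_opNorm₂ a b).trans ?_
    have := (norm_nonneg a).trans ha
    gcongr
  set S : C(K, ℂ) := ∑ i ∈ Finset.range (N+1), (i : ℂ) • hatf Y i with hS
  have one : ∑ i ∈ Finset.range (N+1), hatf Y i = 1 := by
    ext t
    rw [ContinuousMap.sum_apply]
    simp only [hatf_apply, ContinuousMap.one_apply]
    have := hat_sum (N+1) 0 (Y t)
    rw [cl_one (by simpa using h1 t), cl_zero (by push_cast; linarith [h2 t])] at this
    simp only [add_zero, sub_zero] at this
    exact_mod_cast this
  have near : ‖ofRe Y - S‖ ≤ 2 := by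
    rw [ContinuousMap.norm_le _ (by norm_num)]
    intro t
    have e1 : (ofRe Y - S) t = ∑ i ∈ Finset.range (N+1), ((Y t : ℂ) - i) * hatf Y i t := by
      have := congrArg (fun g : C(K, ℂ) => g t) one
      simp only [ContinuousMap.sum_apply, ContinuousMap.one_apply] at this
      simp only [sub_mul, Finset.sum_sub_distrib]
      rw [← Finset.mul_sum, this, ContinuousMap.sub_apply, hS, ContinuousMap.sum_apply]
      simp [ofRe]
    rw [e1]
    refine (norm_sum_le _ _).trans ?_
    calc _ ≤ ∑ i ∈ Finset.range (N+1), 2 * hat (i+0) (Y t) := by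
          apply Finset.sum_le_sum
          intro i _
          rw [norm_mul, hatf_apply, Complex.norm_real, Real.norm_of_nonneg (hat_nonneg _ _), add_zero]
          have e2 : ‖(Y t : ℂ) - i‖ = |Y t - i| := by
            rw [← Complex.ofReal_natCast, ← Complex.ofReal_sub, Complex.norm_real]; rfl
          rw [e2]
          rcases le_total (Y t) i with h | h
          · rw [hat_left i h]; simp
          rcases le_total ((i : ℝ) + 2) (Y t) with h' | h'
          · rw [hat_right i h']; simp
          · have := hat_nonneg i (Y t)
            gcongr
            rw [abs_le]; constructor <;> linarith
      _ ≤ 2 := by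
          rw [← Finset.mul_sum]; linarith [hat_sum_le (N+1) 0 (Y t)]
  have hD : B (x * S) z - B x (z * S) =
      ∑ i ∈ Finset.range (N+1), ∑ j ∈ Finset.range (N+1),
        ((i : ℂ) - j) * B (x * hatf Y i) (z * hatf Y j) := by
    have ez : z = ∑ j ∈ Finset.range (N+1), z * hatf Y j := by rw [← Finset.mul_sum, one, mul_one]
    have ex : x = ∑ j ∈ Finset.range (N+1), x * hatf Y j := by rw [← Finset.mul_sum, one, mul_one]
    have t1 : B (x * S) z = ∑ i ∈ Finset.range (N+1), ∑ j ∈ Finset.range (N+1),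
        (i : ℂ) * B (x * hatf Y i) (z * hatf Y j) := by
      conv_lhs => rw [hS, Finset.mul_sum, map_sum, ContinuousLinearMap.sum_apply]
      refine Finset.sum_congr rfl fun i _ => ?_
      conv_lhs => rw [ez, map_sum]
      refine Finset.sum_congr rfl fun j _ => ?_
      simp
    have t2 : B x (z * S) = ∑ i ∈ Finset.range (N+1), ∑ j ∈ Finset.range (N+1),
        (j : ℂ) * B (x * hatf Y i) (z * hatf Y j) := by
      conv_lhs => rw [ex, map_sum, ContinuousLinearMap.sum_apply]
      refine Finset.sum_congr rfl fun i _ => ?_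
      conv_lhs => rw [hS, Finset.mul_sum, map_sum]
      refine Finset.sum_congr rfl fun j _ => ?_
      simp
    rw [t1, t2, ← Finset.sum_sub_distrib]
    refine Finset.sum_congr rfl fun i _ => ?_
    rw [← Finset.sum_sub_distrib]
    refine Finset.sum_congr rfl fun j _ => ?_
    ring
  have havg : ∀ m m' : ℕ, ‖∑ i ∈ Finset.range N, B (x * hatf Y (i+m)) (z * hatf Y (i+m'))‖
      ≤ ‖B‖ * ‖x‖ * ‖z‖ := by
    intro m m'
    have := sign_avg (fun a b => B a b) (by simp) (by simp) (by simp) (by simp)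
      (fun i => x * hatf Y (i+m)) (fun i => z * hatf Y (i+m')) (‖B‖ * ‖x‖ * ‖z‖) N 0 0 (by
        intro e he
        simp only [zero_add]
        exact hBn _ _ _ _ (hatf_signs Y N m e he x) (hatf_signs Y N m' e he z))
    simpa using this
  have hDb : ‖B (x * S) z - B x (z * S)‖ ≤ 2 * (‖B‖ * ‖x‖ * ‖z‖) := by
    rw [hD, adj_sum]
    · have e1 : ∀ i : ℕ, (((i+1 : ℕ) : ℂ) - i) = 1 := by intro i; push_cast; ring
      have e2 : ∀ i : ℕ, ((i : ℂ) - (i+1 : ℕ)) = -1 := by intro i; push_cast; ring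
      simp only [e1, e2, one_mul, neg_mul, Finset.sum_neg_distrib]
      refine (norm_add_le _ _).trans ?_
      rw [norm_neg]
      have a1 := havg 1 0
      have a2 := havg 0 1
      simp only [add_zero] at a1 a2
      linarith
    · intro i; simp
    · intro i j h
      rw [hB, mul_zero]
      rw [mul_mul_mul_comm, hatf_orth Y h, mul_zero]
    · intro i j h
      rw [hB, mul_zero]
      rw [mul_mul_mul_comm, mul_comm (hatf Y j), hatf_orth Y h, mul_zero]
  have n1 : ‖B (x * (ofRe Y - S)) z‖ ≤ ‖B‖ * (‖x‖ * 2) * ‖z‖ :=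
    hBn _ _ _ _ ((norm_mul_le _ _).trans (by gcongr)) le_rfl
  have n2 : ‖B x (z * (ofRe Y - S))‖ ≤ ‖B‖ * ‖x‖ * (‖z‖ * 2) :=
    hBn _ _ _ _ le_rfl ((norm_mul_le _ _).trans (by gcongr))
  have e : B (x * ofRe Y) z - B x (z * ofRe Y) =
      B (x * (ofRe Y - S)) z - B x (z * (ofRe Y - S)) + (B (x * S) z - B x (z * S)) := by
    simp only [mul_sub, map_sub, ContinuousLinearMap.sub_apply]; ring
  rw [e]
  refine (norm_add_le _ _).trans ?_
  have := norm_sub_le (B (x * (ofRe Y - S)) z) (B x (z * (ofRe Y - S)))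
  nlinarith

theorem bilin_real (B : C(K, ℂ) →L[ℂ] C(K, ℂ) →L[ℂ] ℂ)
    (hB : ∀ x y, x * y = 0 → B x y = 0) (Y : C(K, ℝ)) (x z : C(K, ℂ)) :
    B (x * ofRe Y) z = B x (z * ofRe Y) := by
  have bd : ∀ n : ℕ, n * ‖B (x * ofRe Y) z - B x (z * ofRe Y)‖ ≤ 6 * (‖B‖ * ‖x‖ * ‖z‖) := by
    intro n
    obtain ⟨N, hN⟩ := exists_nat_ge (n * ‖Y‖)
    have hy : ∀ t, |n * Y t| ≤ N := by
      intro t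
      rw [abs_mul, Nat.abs_cast]
      exact le_trans (by gcongr; exact Y.norm_coe_le_norm t) hN
    have := bilin_bound B hB ((n : ℝ) • Y + ContinuousMap.const K (N + 1 : ℝ)) (2 * N + 1)
      (fun t => by have := (abs_le.1 (hy t)).1; simp; linarith)
      (fun t => by have := (abs_le.1 (hy t)).2; simp; linarith) x z
    have e : ofRe ((n : ℝ) • Y + ContinuousMap.const K (N + 1 : ℝ)) =
        (n : ℂ) • ofRe Y + ((N : ℂ) + 1) • (1 : C(K, ℂ)) := by
      ext t; simp [ofRe]
    rw [e] at this
    simp only [mul_add, mul_smul_comm, mul_one, map_add, map_smul, ContinuousLinearMap.add_apply,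
      ContinuousLinearMap.smul_apply, add_sub_add_right_eq_sub, ← smul_sub, norm_smul] at this
    simpa using this
  by_contra hne
  have hpos : 0 < ‖B (x * ofRe Y) z - B x (z * ofRe Y)‖ := norm_pos_iff.2 (sub_ne_zero.2 hne)
  obtain ⟨n, hn⟩ := exists_nat_gt (6 * (‖B‖ * ‖x‖ * ‖z‖) / ‖B (x * ofRe Y) z - B x (z * ofRe Y)‖)
  rw [div_lt_iff₀ hpos] at hn
  exact absurd (bd n) (not_le.2 hn)

theorem bilin_main (B : C(K, ℂ) →L[ℂ] C(K, ℂ) →L[ℂ] ℂ)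
    (hB : ∀ x y, x * y = 0 → B x y = 0) (x y : C(K, ℂ)) :
    B x y = B (x * y) 1 := by
  let Y : C(K, ℝ) := ⟨fun t => (y t).re, by fun_prop⟩
  let Z : C(K, ℝ) := ⟨fun t => (y t).im, by fun_prop⟩
  have e : y = ofRe Y + Complex.I • ofRe Z := by
    ext t
    simp only [ofRe, Y, Z, ContinuousMap.add_apply, ContinuousMap.smul_apply, ContinuousMap.coe_mk, smul_eq_mul]
    rw [mul_comm, Complex.re_add_im]
  have h1 := bilin_real B hB Y x 1
  have h2 := bilin_real B hB Z x 1
  rw [one_mul] at h1 h2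
  rw [e, mul_add, mul_smul_comm, map_add, map_add, map_smul, map_smul,
    ContinuousLinearMap.add_apply, ContinuousLinearMap.smul_apply, h1, h2]


def Sym {n : ℕ} (M : ContinuousMultilinearMap ℂ (fun _ : Fin n => C(K, ℂ)) ℂ) : Prop :=
  ∀ (σ : Equiv.Perm (Fin n)) (x : Fin n → C(K, ℂ)), M (x ∘ σ) = M x

theorem deriv_diag {n : ℕ} (M : ContinuousMultilinearMap ℂ (fun _ : Fin (n+1) => C(K, ℂ)) ℂ)
    (hM : Sym M) (x h : C(K, ℂ)) :
    HasDerivAt (fun s : ℂ => M (fun _ => x + s • h)) ((n + 1 : ℂ) * M (Fin.cons h (fun _ => x))) 0 := by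
  have h1 : HasDerivAt (fun s : ℂ => (fun _ : Fin (n+1) => x + s • h)) (fun _ => h) 0 := by
    rw [hasDerivAt_pi]
    intro i
    simpa using ((hasDerivAt_id (0:ℂ)).smul_const h).const_add x
  have h2 := (M.hasFDerivAt (fun _ => x + (0:ℂ) • h)).comp_hasDerivAt (0:ℂ) h1
  refine h2.congr_deriv ?_
  rw [ContinuousMultilinearMap.linearDeriv_apply]
  have : ∀ i : Fin (n+1), M (Function.update (fun _ => x + (0:ℂ) • h) i h) = M (Fin.cons h (fun _ => x)) := by
    intro i
    rw [← hM (Equiv.swap 0 i) (Fin.cons h (fun _ => x))]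
    congr 1
    funext j
    by_cases hj : j = i
    · subst hj; simp
    · have : Equiv.swap 0 i j ≠ 0 := by
        intro h0
        apply hj
        rw [Equiv.swap_apply_eq_iff] at h0
        simpa using h0
      obtain ⟨j', hj'⟩ := Fin.exists_succ_eq.2 this
      simp [hj, ← hj']
  rw [Finset.sum_congr rfl (fun i _ => this i)]
  simp

variable {n : ℕ} (M : ContinuousMultilinearMap ℂ (fun _ : Fin (n+2) => C(K, ℂ)) ℂ)

theorem L1 (hM : Sym M) (hO : IsOrthAdd (fun x => M (fun _ => x))) (x y h : C(K, ℂ))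
    (hxy : x * y = 0) (hxh : x * h = 0) :
    M (Fin.cons h (fun _ => x + y)) = M (Fin.cons h (fun _ => y)) := by
  have h1 := deriv_diag M hM (x + y) h
  have h2 := (deriv_diag M hM y h).const_add (M (fun _ => x))
  have e : (fun s : ℂ => M (fun _ => x + y + s • h)) = fun s : ℂ => M (fun _ => x) + M (fun _ => y + s • h) := by
    funext s
    have := hO x (y + s • h) (by rw [mul_add, mul_smul_comm, hxy, hxh]; simp)
    simpa only [add_assoc] using this
  rw [e] at h1
  have h3 := h1.unique h2
  refine mul_left_cancel₀ ?_ h3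
  exact_mod_cast (Nat.succ_ne_zero (n + 1))

theorem L2 (hM : Sym M) (hO : IsOrthAdd (fun x => M (fun _ => x))) (x h : C(K, ℂ))
    (hxh : x * h = 0) : M (Fin.cons h (fun _ => x)) = 0 := by
  have := L1 M hM hO x 0 h (by simp) hxh
  rw [add_zero] at this
  rw [this]
  exact M.map_coord_zero (1 : Fin (n+2)) rfl

theorem L3 (hM : Sym M) (hO : IsOrthAdd (fun x => M (fun _ => x))) (x y h : C(K, ℂ))
    (hxy : x * y = 0) (hxh : x * h = 0) :
    M (Fin.cons h (fun _ => x + y)) = M (Fin.cons h (fun _ => x)) + M (Fin.cons h (fun _ => y)) := by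
  rw [L1 M hM hO x y h hxy hxh, L2 M hM hO x h hxh, zero_add]

theorem cons_add' (h₁ h₂ x : C(K, ℂ)) : M (Fin.cons (h₁ + h₂) (fun _ => x)) =
    M (Fin.cons h₁ (fun _ => x)) + M (Fin.cons h₂ (fun _ => x)) := by
  have := M.curryLeft.map_add h₁ h₂
  have := congrArg (fun g => g (fun _ => x)) this
  exact this

theorem L4 (hM : Sym M) (hO : IsOrthAdd (fun x => M (fun _ => x))) (h : C(K, ℂ)) :
    IsOrthAdd (fun x => M.curryLeft h (fun _ => x)) := by
  intro x y hxy
  let χ : ℕ → C(K, ℂ) := fun n => ⟨fun t => ((max 0 (min 1 (n * ‖x t‖ - 1)) : ℝ) : ℂ), by fun_prop⟩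
  let u : ℕ → C(K, ℂ) := fun n => ⟨fun t => ((min 1 (n * ‖x t‖) : ℝ) : ℂ), by fun_prop⟩
  have hlim : Tendsto (fun n => x * χ n) atTop (𝓝 x) := by
    rw [tendsto_iff_norm_sub_tendsto_zero]
    refine squeeze_zero' (Eventually.of_forall fun _ => norm_nonneg _) (g := fun n : ℕ => 2 / (n : ℝ)) ?_
      (tendsto_const_div_atTop_nhds_zero_nat 2)
    filter_upwards [eventually_gt_atTop 0] with n hn
    have hn' : (0:ℝ) < n := by exact_mod_cast hn
    rw [ContinuousMap.norm_le _ (by positivity)]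
    intro t
    have e : (x * χ n - x) t = x t * (((max 0 (min 1 (n * ‖x t‖ - 1)) - 1 : ℝ)) : ℂ) := by
      simp [χ]; ring
    rw [e, norm_mul, Complex.norm_real, Real.norm_eq_abs, le_div_iff₀ hn']
    have hx0 := norm_nonneg (x t)
    rcases le_total 2 (n * ‖x t‖) with h2 | h2
    · rw [min_eq_left (by linarith)]; simp
    · have : |max 0 (min 1 (n * ‖x t‖ - 1)) - 1| ≤ 1 := by
        have a := le_max_left 0 (min 1 (n * ‖x t‖ - 1))
        have b : max 0 (min 1 (n * ‖x t‖ - 1)) ≤ 1 := max_le zero_le_one (min_le_left _ _)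
        rw [abs_le]; constructor <;> linarith
      calc _ ≤ ‖x t‖ * 1 * n := by gcongr
        _ ≤ 2 := by linarith
  have hxy' : ∀ t, x t = 0 ∨ y t = 0 := fun t => by
    have := congrArg (fun g : C(K, ℂ) => g t) hxy
    simpa using this
  have main : ∀ n, M (Fin.cons h (fun _ => x * χ n + y)) =
      M (Fin.cons h (fun _ => x * χ n)) + M (Fin.cons h (fun _ => y)) := by
    intro n
    have o1 : x * χ n * y = 0 := by rw [mul_right_comm, hxy, zero_mul]
    have o2 : x * χ n * ((1 - u n) * h) = 0 := by
      ext t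
      have : χ n t = 0 ∨ 1 - u n t = 0 := by
        simp only [χ, u, ContinuousMap.coe_mk]
        rcases le_total 1 (n * ‖x t‖) with h1 | h1
        · right; rw [min_eq_left h1]; simp
        · left; rw [max_eq_left]; · simp
          exact (min_le_right _ _).trans (by linarith)
      simp only [ContinuousMap.mul_apply, ContinuousMap.sub_apply, ContinuousMap.one_apply, ContinuousMap.zero_apply]
      rcases this with h | h <;> rw [h] <;> simp
    have o3 : y * (u n * h) = 0 := by
      ext t
      rcases hxy' t with h | h
      · simp [u, h]
      · simp [h]
    have eh : h = (1 - u n) * h + u n * h := by ring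
    conv_lhs => rw [eh]
    conv_rhs => rw [eh]
    simp only [cons_add']
    rw [L3 M hM hO _ _ _ o1 o2, add_comm (x * χ n) y,
      L3 M hM hO y (x * χ n) _ (by rw [mul_comm]; exact o1) o3]
    ring
  have c1 : Continuous (fun z : C(K, ℂ) => M.curryLeft h (fun _ => z)) :=
    (M.curryLeft h).cont.comp (continuous_pi fun _ => continuous_id)
  have t1 := (c1.tendsto (x + y)).comp (hlim.add_const y)
  have t2 := ((c1.tendsto x).comp hlim).add_const (M.curryLeft h (fun _ => y))
  exact tendsto_nhds_unique t1 (t2.congr fun n => (main n).symm)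

theorem sym_curry (hM : Sym M) (h : C(K, ℂ)) : Sym (M.curryLeft h) := by
  intro σ x
  rw [ContinuousMultilinearMap.curryLeft_apply, ContinuousMultilinearMap.curryLeft_apply]
  let τ : Equiv.Perm (Fin (n+2)) := Equiv.Perm.decomposeFin.symm (0, σ)
  rw [← hM τ (Fin.cons h x)]
  congr 1
  funext j
  refine Fin.cases ?_ (fun j => ?_) j
  · simp [τ]
  · simp [τ]

theorem rep_two (M : ContinuousMultilinearMap ℂ (fun _ : Fin 2 => C(K, ℂ)) ℂ)
    (hM : Sym M) (hO : IsOrthAdd (fun x => M (fun _ => x))) (x y : C(K, ℂ)) :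
    M ![x, y] = M ![x * y, 1] := by
  let B : C(K, ℂ) →L[ℂ] C(K, ℂ) →L[ℂ] ℂ :=
    ((continuousMultilinearCurryFin1 ℂ C(K, ℂ) ℂ).toContinuousLinearEquiv.toContinuousLinearMap).comp M.curryLeft
  have hBa : ∀ a b, B a b = M ![a, b] := by
    intro a b
    change M (Fin.cons a (Fin.snoc 0 b)) = _
    congr 1
    funext i; fin_cases i <;> rfl
  have hB : ∀ a b, a * b = 0 → B a b = 0 := by
    intro a b hab
    have h1 := hO a b hab
    have e : ∀ c : C(K, ℂ), M (fun _ => c) = B c c := by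
      intro c; rw [hBa]; congr 1; funext i; fin_cases i <;> rfl
    have hs : B b a = B a b := by
      rw [hBa, hBa, ← hM (Equiv.swap 0 1)]
      congr 1; funext i; fin_cases i <;> simp
    simp only [e, map_add, ContinuousLinearMap.add_apply, hs] at h1
    have : 2 * B a b = 0 := by linear_combination h1
    simpa using this
  rw [← hBa, ← hBa, bilin_main B hB]

theorem rep (n : ℕ) : ∀ (M : ContinuousMultilinearMap ℂ (fun _ : Fin (n+1) => C(K, ℂ)) ℂ)
    (_ : Sym M) (_ : IsOrthAdd (fun x => M (fun _ => x))) (x : Fin (n+1) → C(K, ℂ)),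
    M x = M (Fin.cons (∏ i, x i) (fun _ => 1)) := by
  induction n with
  | zero =>
    intro M _ _ x
    congr 1; funext i; fin_cases i; simp
  | succ n ih =>
    cases n with
    | zero =>
      intro M hM hO x
      have h := rep_two M hM hO (x 0) (x 1)
      convert h using 2
      · funext i; fin_cases i <;> rfl
      · funext i; fin_cases i <;> simp
    | succ n =>
      intro M hM hO x
      have step : ∀ (h : C(K, ℂ)) (z : Fin (n+2) → C(K, ℂ)),
          M (Fin.cons h z) = M (Fin.cons h (Fin.cons (∏ i, z i) (fun _ => 1))) := by
        intro h z
        exact ih (M.curryLeft h) (sym_curry M hM h) (L4 M hM hO h) z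
      set p := ∏ i : Fin (n+2), x i.succ with hp
      have a1 : M x = M (Fin.cons (x 0) (Fin.cons p (fun _ => 1))) := by
        have := step (x 0) (fun i => x i.succ)
        rw [← this]; congr 1; exact (Fin.cons_self_tail x).symm
      have hv : ((2 : Fin (n+1+1+1)) : ℕ) = 2 :=
        Nat.mod_eq_of_lt (show 2 < n+1+1+1 by omega)
      have a2 : M (Fin.cons (x 0) (Fin.cons p (fun _ => 1))) =
          M (Fin.cons 1 (Fin.cons p (Fin.cons (x 0) (fun _ => 1)))) := by
        rw [← hM (Equiv.swap 0 2)]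
        congr 1
        funext j
        refine Fin.cases ?_ (fun j => Fin.cases ?_ (fun j => Fin.cases ?_ (fun j => ?_) j) j) j
        · rw [Function.comp, Equiv.swap_apply_left]; rfl
        · rw [Function.comp, Equiv.swap_apply_of_ne_of_ne]; · rfl
          · simp
          · intro h; exact absurd (congrArg Fin.val h) (by rw [hv]; simp)
        · rw [Function.comp, show (Fin.succ (Fin.succ 0) : Fin (n+1+1+1)) = 2 from rfl, Equiv.swap_apply_right]; rfl
        · rw [Function.comp, Equiv.swap_apply_of_ne_of_ne]; · rfl
          · simp
          · intro h; exact absurd (congrArg Fin.val h) (by rw [hv]; simp)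
      have a3 := step 1 (Fin.cons p (Fin.cons (x 0) (fun _ => 1)))
      have a4 : ∏ i, (Fin.cons p (Fin.cons (x 0) (fun _ => 1)) : Fin (n+2) → C(K, ℂ)) i = ∏ i, x i := by
        rw [Fin.prod_univ_succ x, Fin.prod_univ_succ, Fin.prod_univ_succ]
        simp [← hp, mul_comm]
      rw [a1, a2, a3, a4, ← hM (Equiv.swap 0 1)]
      congr 1
      funext j
      refine Fin.cases ?_ (fun j => Fin.cases ?_ (fun j => ?_) j) j
      · rw [Function.comp, Equiv.swap_apply_left]; rfl
      · rw [Function.comp, show (Fin.succ 0 : Fin (n+1+1+1)) = 1 from rfl, Equiv.swap_apply_right]; rfl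
      · rw [Function.comp, Equiv.swap_apply_of_ne_of_ne]; · rfl
        · simp
        · intro h; exact absurd (congrArg Fin.val h) (by simp; try omega)

theorem exists_sym {n : ℕ} (M : ContinuousMultilinearMap ℂ (fun _ : Fin n => C(K, ℂ)) ℂ) :
    ∃ M' : ContinuousMultilinearMap ℂ (fun _ : Fin n => C(K, ℂ)) ℂ, Sym M' ∧
      ∀ x, M' (fun _ => x) = M (fun _ => x) := by
  refine ⟨((n.factorial : ℂ)⁻¹) • ∑ σ : Equiv.Perm (Fin n), M.domDomCongr σ, ?_, ?_⟩
  · intro τ x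
    simp only [ContinuousMultilinearMap.smul_apply, ContinuousMultilinearMap.sum_apply,
      ContinuousMultilinearMap.domDomCongr_apply]
    congr 1
    exact Fintype.sum_equiv (Equiv.mulLeft τ) _ _ (fun σ => rfl)
  · intro x
    simp only [ContinuousMultilinearMap.smul_apply, ContinuousMultilinearMap.sum_apply,
      ContinuousMultilinearMap.domDomCongr_apply]
    simp [Fintype.card_perm, Nat.factorial_ne_zero]

theorem exists_lin (k : ℕ) (hk : 1 ≤ k) (M : ContinuousMultilinearMap ℂ (fun _ : Fin k => C(K, ℂ)) ℂ)
    (hO : IsOrthAdd (fun x => M (fun _ => x))) :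
    ∃ l : C(K, ℂ) →L[ℂ] ℂ, ∀ x, M (fun _ => x) = l (x ^ k) := by
  obtain ⟨n, rfl⟩ : ∃ n, k = n + 1 := ⟨k - 1, by omega⟩
  obtain ⟨M', hs, hM'⟩ := exists_sym M
  have hO' : IsOrthAdd (fun x => M' (fun _ => x)) := by simpa only [hM'] using hO
  refine ⟨M'.toContinuousLinearMap (fun _ => 1) 0, fun x => ?_⟩
  rw [← hM', rep n M' hs hO']
  simp only [ContinuousMultilinearMap.toContinuousLinearMap_apply]
  congr 1
  funext i
  refine Fin.cases ?_ (fun i => ?_) i <;> simp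

noncomputable def jmap (k : ℕ) : C(K, ℂ) →ₗ[ℝ] C(Circle × K, ℝ) where
  toFun x := ⟨fun p => (((p.1 : ℂ)) ^ k * x p.2).re, by fun_prop⟩
  map_add' x y := by ext p; simp [mul_add]
  map_smul' c x := by ext p; simp; ring

theorem riesz [T2Space K] (k : ℕ) (hk : 1 ≤ k) (l : C(K, ℂ) →L[ℂ] ℂ) :
    ∃ (m : MeasurableSpace (Circle × K)) (_ : BorelSpace (Circle × K)) (μ : Measure (Circle × K)),
      IsFiniteMeasure μ ∧ ∀ x, l x = ∫ p, (p.1 : ℂ) ^ k * x p.2 ∂μ := by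
  let m : MeasurableSpace (Circle × K) := borel _
  have : BorelSpace (Circle × K) := ⟨rfl⟩
  -- norm bound
  have hj : ∀ x : C(K, ℂ), ‖x‖ ≤ ‖jmap k x ⊔ 0‖ := by
    intro x
    rw [ContinuousMap.norm_le _ (norm_nonneg _)]
    intro t
    obtain ⟨s, hs⟩ : ∃ s : Circle, ((s : ℂ) ^ k * x t) = ‖x t‖ := by
      refine ⟨Circle.exp (-(Complex.arg (x t)) / k), ?_⟩
      have hk' : (k : ℂ) ≠ 0 := by exact_mod_cast (by omega : k ≠ 0)
      rw [Circle.coe_exp, ← Complex.exp_nat_mul]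
      have hz := Complex.norm_mul_exp_arg_mul_I (x t)
      generalize Complex.arg (x t) = θ at hz ⊢
      rw [← hz, norm_mul, Complex.norm_exp_ofReal_mul_I, mul_one, mul_left_comm, ← Complex.exp_add]
      have : (k : ℂ) * (((-θ / k : ℝ) : ℂ) * Complex.I) + θ * Complex.I = 0 := by
        push_cast; field_simp; ring
      rw [this]; simp
    have h := (jmap k x ⊔ 0).norm_coe_le_norm (s, t)
    refine le_trans ?_ h
    have e : (jmap k x ⊔ 0) (s, t) = ‖x t‖ := by
      change max ((s : ℂ) ^ k * x t).re 0 = _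
      rw [hs]; simp
    rw [e]; simp
  have hinj : Function.Injective (jmap (K := K) k) := by
    rw [injective_iff_map_eq_zero]
    intro x hx
    have := hj x
    rw [hx] at this
    simpa using this
  let e := LinearEquiv.ofInjective (jmap (K := K) k) hinj
  let lr : C(K, ℂ) →ₗ[ℝ] ℝ := Complex.reLm ∘ₗ (l.toLinearMap.restrictScalars ℝ)
  let f : C(Circle × K, ℝ) →ₗ.[ℝ] ℝ := ⟨LinearMap.range (jmap (K := K) k), lr ∘ₗ e.symm.toLinearMap⟩
  obtain ⟨L, hL1, hL2⟩ := exists_extension_of_le_sublinear f (fun g => ‖l‖ * ‖g ⊔ 0‖)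
    (by
      intro c hc g
      have : (c • g) ⊔ 0 = c • (g ⊔ 0) := by
        ext p
        simp only [ContinuousMap.sup_apply, ContinuousMap.smul_apply, ContinuousMap.zero_apply, smul_eq_mul]
        rw [mul_max_of_nonneg _ _ hc.le, mul_zero]
      simp only [this, norm_smul, Real.norm_of_nonneg hc.le]; ring)
    (by
      intro g h
      rw [← mul_add]
      gcongr
      rw [ContinuousMap.norm_le _ (by positivity)]
      intro p
      have h1 := (g ⊔ 0).norm_coe_le_norm p
      have h2 := (h ⊔ 0).norm_coe_le_norm p
      simp only [ContinuousMap.sup_apply, ContinuousMap.add_apply, ContinuousMap.zero_apply, Real.norm_eq_abs] at *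
      rw [abs_of_nonneg (le_max_right _ _)] at *
      refine max_le ?_ (by positivity)
      linarith [le_max_left (g p) 0, le_max_left (h p) 0])
    (by
      rintro ⟨g, x, rfl⟩
      have : e.symm ⟨jmap k x, ⟨x, rfl⟩⟩ = x := by
        rw [LinearEquiv.symm_apply_eq]; rfl
      change lr (e.symm ⟨jmap k x, ⟨x, rfl⟩⟩) ≤ ‖l‖ * ‖jmap k x ⊔ 0‖
      rw [this]
      change (l x).re ≤ _
      refine (Complex.re_le_norm _).trans ((l.le_opNorm x).trans ?_)
      gcongr
      exact hj x)
  have hLx : ∀ x, L (jmap k x) = (l x).re := by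
    intro x
    have h := hL1 ⟨jmap k x, ⟨x, rfl⟩⟩
    have : e.symm ⟨jmap k x, ⟨x, rfl⟩⟩ = x := by
        rw [LinearEquiv.symm_apply_eq]; rfl
    change L (jmap k x) = lr (e.symm ⟨jmap k x, ⟨x, rfl⟩⟩) at h
    rw [this] at h
    exact h
  have hLneg : ∀ g, g ≤ 0 → L g ≤ 0 := by
    intro g hg
    have := hL2 g
    rwa [sup_eq_right.2 hg, norm_zero, mul_zero] at this
  let Λ : CompactlySupportedContinuousMap (Circle × K) ℝ →ₚ[ℝ] ℝ :=
  { toFun g := L g.toContinuousMap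
    map_add' g g' := L.map_add _ _
    map_smul' c g := L.map_smul c _
    monotone' g g' hgg' := by
      have := hLneg (g.toContinuousMap - g'.toContinuousMap) (by
        intro p; simpa using hgg' p)
      rw [map_sub] at this
      change L g.toContinuousMap ≤ L g'.toContinuousMap
      linarith }
  refine ⟨m, ⟨rfl⟩, RealRMK.rieszMeasure Λ, inferInstance, ?_⟩
  have hre : ∀ x : C(K, ℂ), (l x).re = ∫ p, ((p.1 : ℂ) ^ k * x p.2).re ∂(RealRMK.rieszMeasure Λ) := by
    intro x
    have := RealRMK.integral_rieszMeasure Λ ⟨jmap k x, HasCompactSupport.of_compactSpace _⟩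
    rw [← hLx]
    exact this.symm
  intro x
  have hint : Integrable (fun p : Circle × K => (p.1 : ℂ) ^ k * x p.2) (RealRMK.rieszMeasure Λ) := by
    apply Continuous.integrable_of_hasCompactSupport (by fun_prop)
    exact HasCompactSupport.of_compactSpace _
  apply Complex.ext
  · rw [hre]
    exact integral_re hint
  · have h := hre (Complex.I • x)
    have e1 : (l (Complex.I • x)).re = - (l x).im := by simp
    have e2 : ∀ p : Circle × K, ((p.1 : ℂ) ^ k * (Complex.I • x) p.2).re = - ((p.1 : ℂ) ^ k * x p.2).im := by
      intro p
      have : ((p.1 : ℂ) ^ k * (Complex.I • x) p.2) = Complex.I * ((p.1 : ℂ) ^ k * x p.2) := by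
        simp; ring
      rw [this]; simp
    simp_rw [e1, e2, integral_neg] at h
    rw [neg_injective h]
    exact integral_im hint

theorem circ_mem (p : Circle × K) (x : C(K, ℂ)) : ‖(p.1 : ℂ) * x p.2‖ ≤ ‖x‖ := by
  rw [norm_mul, Circle.norm_coe, one_mul]; exact x.norm_coe_le_norm _

noncomputable def pt (p : Circle × K) : DualBall K :=
  ⟨StrongDual.toWeakDual ((p.1 : ℂ) • ContinuousMap.evalCLM ℂ p.2), fun x => circ_mem p x⟩

theorem pt_apply (p : Circle × K) (x : C(K, ℂ)) : (pt p).1 x = (p.1 : ℂ) * x p.2 := rfl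

theorem pt_cont : Continuous (pt (K := K)) := by
  refine Continuous.subtype_mk ?_ _
  refine WeakDual.continuous_of_continuous_eval fun x => ?_
  change Continuous fun p : Circle × K => (p.1 : ℂ) * x p.2
  fun_prop

end OrthAddAux

/-- Every orthogonally additive continuous `k`-homogeneous polynomial on `C(K)` is
integral: it is represented by a complex Borel measure (encoded in polar form
`w · ν` with `ν` a finite positive Borel measure and `w` unimodular) on the
weak-* closed unit ball of the dual. -/
theorem orthAdd_homogPoly_integral
    {K : Type*} [TopologicalSpace K] [CompactSpace K] [T2Space K]
    (k : ℕ) (hk : 1 ≤ k) (P : C(K, ℂ) → ℂ)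
    (hP : IsHomogPoly k P) (hOA : IsOrthAdd P) :
    ∃ (ν : Measure (DualBall K)) (w : DualBall K → ℂ),
      IsFiniteMeasure ν ∧ Measurable w ∧ (∀ γ, ‖w γ‖ = 1) ∧
      ∀ x : C(K, ℂ), P x = ∫ γ, (γ.1 x) ^ k * w γ ∂ν := by
  obtain ⟨M, hM⟩ := hP
  obtain rfl : P = fun x => M (fun _ => x) := funext hM
  obtain ⟨l, hl⟩ := OrthAddAux.exists_lin k hk M hOA
  obtain ⟨m, hb, μ, hμ, hint⟩ := OrthAddAux.riesz k hk l
  have hbB : BorelSpace (DualBall K) := ⟨rfl⟩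
  have hmeas : Measurable (OrthAddAux.pt (K := K)) := OrthAddAux.pt_cont.measurable
  refine ⟨μ.map OrthAddAux.pt, fun _ => 1, inferInstance, measurable_const, by simp, fun x => ?_⟩
  have hc : Continuous (fun γ : DualBall K => (γ.1 x) ^ k * (1 : ℂ)) := by
    have : Continuous (fun γ : DualBall K => γ.1 x) :=
      (WeakDual.eval_continuous x).comp continuous_subtype_val
    fun_prop
  rw [integral_map hmeas.aemeasurable hc.measurable.aestronglyMeasurable]
  simp only [OrthAddAux.pt_apply, mul_one, mul_pow]
  rw [hl, hint]
  rfl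
end
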